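/- arXiv:2212.12692 — 2 statements merged into one kernel-verified Lean document; each statement's English description precedes it below -/
import Mathlib

section
/- Let α ∈ (0,1), a < b reals, let A be a real symmetric positive semidefinite d×d matrix with largest eigenvalue λ, let M ≥ 0 and let g : [a,b] → ℝ be continuous with 0 ≤ g(t) ≤ M for all t. If Ψ : [a,b] → ℝ^{d×d} is continuous and satisfies Ψ(t) = 𝕀 − (1/Γ(α)) ∫_a^t (t−s)^{α−1} g(s) A Ψ(s) ds for all t ∈ [a,b], then for every t ∈ [a,b]: E_α(−λ M (b−a)^α) ≤ ‖Ψ(t)‖ ≤ 1, where ‖·‖ is the operator norm induced by the Euclidean norm. -/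
open MeasureTheory Set Matrix

attribute [local instance] Matrix.normedAddCommGroup Matrix.normedSpace

/-- The one-parameter Mittag-Leffler function `E_α(x) = Σ_{k=0}^∞ x^k / Γ(αk+1)`. -/
noncomputable def mittagLeffler (α x : ℝ) : ℝ :=
  ∑' k : ℕ, x ^ k / Real.Gamma (α * k + 1)

/-- The kernel `(t - s)^(α-1)` is interval integrable in `s`. -/
lemma intervalIntegrable_kernel {α : ℝ} (hα : 0 < α) (t x y : ℝ) :
    IntervalIntegrable (fun s : ℝ => (t - s) ^ (α - 1)) volume x y := by
  have h := (intervalIntegral.intervalIntegrable_rpow' (a := t - x) (b := t - y)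
    (r := α - 1) (by linarith)).comp_sub_left t
  simpa using h

lemma intervalIntegrable_kernel_mul {α : ℝ} (hα : 0 < α) (t : ℝ) {x y : ℝ} {q : ℝ → ℝ}
    (hxy : x ≤ y) (hq : ContinuousOn q (Icc x y)) :
    IntervalIntegrable (fun s : ℝ => (t - s) ^ (α - 1) * q s) volume x y :=
  (intervalIntegrable_kernel hα t x y).mul_continuousOn (by rwa [uIcc_of_le hxy])

lemma integral_kernel {α : ℝ} (hα : 0 < α) (x t : ℝ) :
    ∫ s in x..t, (t - s) ^ (α - 1) = (t - x) ^ α / α := by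
  rw [intervalIntegral.integral_comp_sub_left (fun s => s ^ (α - 1)) t,
    integral_rpow (Or.inl (by linarith))]
  simp [Real.zero_rpow hα.ne']

/-- Comparison of the kernels at two times, for `0 ≤ s < p ≤ t`. -/
lemma kernel_le_mul_kernel {α s p t : ℝ} (hα : α ≤ 1) (hs : 0 ≤ s) (hsp : s < p) (hpt : p ≤ t) :
    (t - s) ^ (α - 1) ≤ (p / t) ^ (1 - α) * (p - s) ^ (α - 1) := by
  have hp : 0 < p := hs.trans_lt hsp
  have ht : 0 < t := hp.trans_le hpt
  have h1 : 0 < p - s := by linarith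
  have h2 : 0 < t - s := by linarith
  have key : (p - s) / (t - s) ≤ p / t := by
    rw [div_le_div_iff₀ h2 ht]; nlinarith
  have h3 : ((p - s) / (t - s)) ^ (1 - α) ≤ (p / t) ^ (1 - α) :=
    Real.rpow_le_rpow (by positivity) key (by linarith)
  have h4 : (t - s) ^ (α - 1) = ((p - s) / (t - s)) ^ (1 - α) * (p - s) ^ (α - 1) := by
    rw [Real.div_rpow h1.le h2.le, show α - 1 = -(1 - α) by ring, Real.rpow_neg h1.le,
      Real.rpow_neg h2.le]
    have := Real.rpow_pos_of_pos h1 (1 - α)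
    field_simp
  rw [h4]
  gcongr

/-- Positivity of solutions of a Volterra equation with kernel `(t - s)^(α-1)`: it suffices that
`t ^ (1 - α) * h t` is nondecreasing for the forcing term `h`. -/
lemma volterra_pos {α L K : ℝ} (hα : α ∈ Ioo (0 : ℝ) 1) {c u h : ℝ → ℝ}
    (hc : ContinuousOn c (Icc 0 L)) (hcb : ∀ t ∈ Icc 0 L, c t ∈ Icc 0 K)
    (hu : ContinuousOn u (Icc 0 L)) (h0 : 0 < h 0)
    (hmono : MonotoneOn (fun t => t ^ (1 - α) * h t) (Icc 0 L))
    (heq : ∀ t ∈ Icc 0 L, u t = h t - ∫ s in (0 : ℝ)..t, (t - s) ^ (α - 1) * (c s * u s)) :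
    ∀ t ∈ Icc 0 L, 0 < u t := by
  obtain ⟨hα0, hα1⟩ := hα
  by_contra! hcon
  obtain ⟨t₀, ht₀, hut₀⟩ := hcon
  have hcomp : IsCompact (Icc 0 L ∩ u ⁻¹' Iic 0) :=
    isCompact_Icc.of_isClosed_subset (hu.preimage_isClosed_of_isClosed isClosed_Icc isClosed_Iic)
      inter_subset_left
  obtain ⟨T, ⟨hT, hTu⟩, hleast⟩ := hcomp.exists_isLeast ⟨t₀, ht₀, hut₀⟩
  have hTu : u T ≤ 0 := hTu
  have hpos : ∀ s ∈ Ico 0 T, 0 < u s := by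
    intro s hs
    by_contra! hneg
    exact absurd (hleast ⟨⟨hs.1, hs.2.le.trans hT.2⟩, hneg⟩) (not_le.2 hs.2)
  have hu0 : u 0 = h 0 := by simpa using heq 0 ⟨le_rfl, hT.1.trans hT.2⟩
  have hT0 : 0 < T := by
    rcases hT.1.lt_or_eq with h | h
    · exact h
    · rw [← h, hu0] at hTu; linarith
  have hK : 0 ≤ K := (hcb T hT).1.trans (hcb T hT).2
  obtain ⟨τ, hτ, hτlt⟩ : ∃ τ ∈ Ioo 0 T, K * ((T - τ) ^ α / α) < τ / T := by
    have hcont : Continuous fun τ : ℝ => τ / T - K * ((T - τ) ^ α / α) := by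
      have : Continuous fun τ : ℝ => (T - τ) ^ α :=
        (continuous_const.sub continuous_id).rpow_const (fun _ => Or.inr hα0.le)
      fun_prop
    have hev : ∀ᶠ τ in nhds T, 0 < τ / T - K * ((T - τ) ^ α / α) :=
      hcont.continuousAt.eventually_const_lt
        (by simp [Real.zero_rpow hα0.ne', div_self hT0.ne'])
    have hev2 : ∀ᶠ τ in nhdsWithin T (Iio T), τ ∈ Ioo 0 T :=
      Ioo_mem_nhdsLT hT0
    obtain ⟨τ, h1, h2⟩ := ((hev.filter_mono nhdsWithin_le_nhds).and hev2).exists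
    exact ⟨τ, h2, by linarith⟩
  obtain ⟨p, hp, hpmax⟩ := isCompact_Icc.exists_isMaxOn (nonempty_Icc.2 hτ.2.le)
    (hu.mono (Icc_subset_Icc hτ.1.le hT.2))
  have hup : 0 < u p := (hpos τ ⟨hτ.1.le, hτ.2⟩).trans_le (hpmax ⟨le_rfl, hτ.2.le⟩)
  have hpT : p < T := by
    rcases hp.2.lt_or_eq with h | h
    · exact h
    · rw [h] at hup; linarith
  have hp0 : 0 < p := hτ.1.trans_le hp.1
  have hpI : p ∈ Icc 0 L := ⟨hp0.le, hpT.le.trans hT.2⟩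
  set q : ℝ → ℝ := fun s => c s * u s with hq
  have hqc : ContinuousOn q (Icc 0 L) := hc.mul hu
  have hqpos : ∀ s ∈ Ico 0 T, 0 ≤ q s := fun s hs =>
    mul_nonneg (hcb s ⟨hs.1, hs.2.le.trans hT.2⟩).1 (hpos s hs).le
  have hqc1 : ContinuousOn q (Icc 0 p) := hqc.mono (Icc_subset_Icc le_rfl hpI.2)
  have hqc2 : ContinuousOn q (Icc p T) := hqc.mono (Icc_subset_Icc hp0.le hT.2)
  set ρ : ℝ := (p / T) ^ (1 - α) with hρ
  have hsplit : ∫ s in (0 : ℝ)..T, (T - s) ^ (α - 1) * q s =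
      (∫ s in (0 : ℝ)..p, (T - s) ^ (α - 1) * q s) + ∫ s in p..T, (T - s) ^ (α - 1) * q s :=
    (intervalIntegral.integral_add_adjacent_intervals
      (intervalIntegrable_kernel_mul hα0 T hp0.le hqc1)
      (intervalIntegrable_kernel_mul hα0 T hpT.le hqc2)).symm
  have h1 : ∫ s in (0 : ℝ)..p, (T - s) ^ (α - 1) * q s ≤
      ρ * ∫ s in (0 : ℝ)..p, (p - s) ^ (α - 1) * q s := by
    rw [← intervalIntegral.integral_const_mul]
    refine intervalIntegral.integral_mono_on_of_le_Ioo hp0.le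
      (intervalIntegrable_kernel_mul hα0 T hp0.le hqc1)
      ((intervalIntegrable_kernel_mul hα0 p hp0.le hqc1).const_mul _) fun s hs => ?_
    rw [← mul_assoc ρ]
    exact mul_le_mul_of_nonneg_right (kernel_le_mul_kernel hα1.le hs.1.le hs.2 hpT.le)
      (hqpos s ⟨hs.1.le, hs.2.trans hpT⟩)
  have h2 : ∫ s in p..T, (T - s) ^ (α - 1) * q s ≤ K * u p * ((T - p) ^ α / α) := by
    rw [← integral_kernel hα0, ← intervalIntegral.integral_const_mul]
    refine intervalIntegral.integral_mono_on_of_le_Ioo hpT.le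
      (intervalIntegrable_kernel_mul hα0 T hpT.le hqc2)
      ((intervalIntegrable_kernel hα0 T p T).const_mul _) fun s hs => ?_
    rw [mul_comm]
    have hsI : s ∈ Icc 0 L := ⟨hp0.le.trans hs.1.le, hs.2.le.trans hT.2⟩
    exact mul_le_mul_of_nonneg_right
      (mul_le_mul (hcb s hsI).2 (hpmax ⟨hp.1.trans hs.1.le, hs.2.le⟩)
        (hpos s ⟨hsI.1, hs.2⟩).le hK) (Real.rpow_nonneg (by linarith [hs.2]) _)
  have h3 : ρ * h p ≤ h T := by
    have := hmono hpI hT hpT.le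
    rw [hρ, Real.div_rpow hp0.le hT0.le, div_mul_eq_mul_div,
      div_le_iff₀ (Real.rpow_pos_of_pos hT0 _)]
    linarith
  have h4 : p / T ≤ ρ := by
    have := Real.rpow_le_rpow_of_exponent_ge (x := p / T) (by positivity)
      ((div_le_one hT0).2 hpT.le) (show 1 - α ≤ 1 by linarith)
    simpa using this
  have h5 : τ / T ≤ p / T := by gcongr; exact hp.1
  have h6 : K * ((T - p) ^ α / α) ≤ K * ((T - τ) ^ α / α) := by
    gcongr
    exact hp.1
  have e1 := heq T hT
  have e2 := heq p hpI
  have h7 : 0 < (ρ - K * ((T - p) ^ α / α)) * u p := mul_pos (by linarith) hup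
  have h8 : ρ * u p = ρ * h p - ρ * ∫ s in (0 : ℝ)..p, (p - s) ^ (α - 1) * q s := by
    rw [e2]; ring
  nlinarith

lemma gamma_add_one_ge {R s : ℝ} (hR : 0 < R) (hs : 0 ≤ s) :
    R ^ s * Real.exp (-R) ≤ Real.Gamma (s + 1) := by
  have hint := Real.GammaIntegral_convergent (s := s + 1) (by linarith)
  rw [Real.Gamma_eq_integral (by linarith), ← integral_exp_neg_Ioi R, ← integral_const_mul]
  calc ∫ x in Ioi R, R ^ s * Real.exp (-x)
      ≤ ∫ x in Ioi R, Real.exp (-x) * x ^ (s + 1 - 1) := by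
        refine setIntegral_mono_on ((integrableOn_exp_neg_Ioi R).const_mul _)
          (hint.mono_set (Ioi_subset_Ioi hR.le)) measurableSet_Ioi fun x hx => ?_
        rw [mul_comm, add_sub_cancel_right]
        have hx' : R ≤ x := le_of_lt hx
        gcongr
    _ ≤ _ := setIntegral_mono_set hint
        ((ae_restrict_mem measurableSet_Ioi).mono fun x hx =>
          mul_nonneg (Real.exp_pos _).le (Real.rpow_nonneg (le_of_lt hx) _))
        (Ioi_subset_Ioi hR.le).eventuallyLE

lemma summable_mittagLeffler {α : ℝ} (hα : 0 < α) (x : ℝ) :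
    Summable fun k : ℕ => x ^ k / Real.Gamma (α * k + 1) := by
  set R : ℝ := (2 * |x| + 1) ^ α⁻¹ with hRdef
  have hR : 0 < R := Real.rpow_pos_of_pos (by positivity) _
  have hRα : R ^ α = 2 * |x| + 1 := by
    rw [hRdef, ← Real.rpow_mul (by positivity), inv_mul_cancel₀ hα.ne', Real.rpow_one]
  have hlt : |x| / (2 * |x| + 1) < 1 := by
    rw [div_lt_one (by positivity)]; linarith [abs_nonneg x]
  refine Summable.of_norm_bounded
    ((summable_geometric_of_lt_one (by positivity) hlt).mul_left (Real.exp R)) fun k => ?_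
  have hk : 0 ≤ α * k := by positivity
  have hg := gamma_add_one_ge hR hk
  rw [Real.rpow_mul hR.le, hRα, Real.rpow_natCast] at hg
  have hΓ : 0 < Real.Gamma (α * k + 1) := Real.Gamma_pos_of_pos (by linarith)
  rw [norm_div, norm_pow, Real.norm_eq_abs, Real.norm_of_nonneg hΓ.le, div_pow, div_le_iff₀ hΓ]
  calc |x| ^ k = Real.exp R * (|x| ^ k / (2 * |x| + 1) ^ k) *
        ((2 * |x| + 1) ^ k * Real.exp (-R)) := by
        rw [Real.exp_neg]
        field_simp
    _ ≤ _ := by gcongr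

lemma continuousOn_mittagLeffler_comp {α : ℝ} (hα : 0 < α) {K : ℝ} (hK : 0 ≤ K) (L : ℝ) :
    ContinuousOn (fun x => mittagLeffler α (-(K * x ^ α))) (Icc 0 L) := by
  have hc : Continuous fun x : ℝ => -(K * x ^ α) :=
    (continuous_const.mul (continuous_id.rpow_const fun _ => Or.inr hα.le)).neg
  refine continuousOn_tsum (u := fun k : ℕ => (K * L ^ α) ^ k / Real.Gamma (α * k + 1))
    (fun k => ((hc.pow k).div_const _).continuousOn) (summable_mittagLeffler hα _) fun k x hx => ?_
  have hΓ : 0 < Real.Gamma (α * k + 1) := Real.Gamma_pos_of_pos (by positivity)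
  have hx0 := hx.1
  rw [norm_div, norm_pow, norm_neg, Real.norm_of_nonneg hΓ.le,
    Real.norm_of_nonneg (mul_nonneg hK (Real.rpow_nonneg hx.1 _))]
  gcongr
  exact hx.2

/-- The fractional integral of order `α` of a power function. -/
lemma integral_kernel_mul_rpow {α r x : ℝ} (hα : 0 < α) (hr : 0 ≤ r) (hx : 0 ≤ x) :
    ∫ s in (0 : ℝ)..x, (x - s) ^ (α - 1) * s ^ r =
      x ^ (r + α) * (Real.Gamma α * Real.Gamma (r + 1) / Real.Gamma (r + α + 1)) := by
  rcases hx.eq_or_lt with rfl | hx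
  · simp [Real.zero_rpow (by linarith : r + α ≠ 0)]
  have h := Complex.betaIntegral_scaled ((r + 1 : ℝ) : ℂ) (α : ℂ) hx
  have h2 := Complex.Gamma_mul_Gamma_eq_betaIntegral (s := ((r + 1 : ℝ) : ℂ)) (t := (α : ℂ))
    (by simp; linarith) (by simpa using hα)
  have hL : ((∫ s in (0 : ℝ)..x, (x - s) ^ (α - 1) * s ^ r : ℝ) : ℂ) =
      ∫ s in (0 : ℝ)..x, (s : ℂ) ^ (((r + 1 : ℝ) : ℂ) - 1) * ((x : ℂ) - s) ^ ((α : ℂ) - 1) := by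
    rw [← intervalIntegral.integral_ofReal]
    refine intervalIntegral.integral_congr fun s hs => ?_
    rw [uIcc_of_le hx.le] at hs
    have hs1 : 0 ≤ x - s := by linarith [hs.2]
    rw [Complex.ofReal_mul, Complex.ofReal_cpow hs1, Complex.ofReal_cpow hs.1]
    push_cast
    rw [mul_comm]
    ring_nf
  have hΓ : Real.Gamma (r + α + 1) ≠ 0 := (Real.Gamma_pos_of_pos (by linarith)).ne'
  have hΓc : Complex.Gamma ((r + 1 : ℝ) + α) = (Real.Gamma (r + α + 1) : ℝ) := by
    rw [← Complex.ofReal_add, Complex.Gamma_ofReal, add_right_comm]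
  rw [hΓc, Complex.Gamma_ofReal, Complex.Gamma_ofReal] at h2
  have hexp : (x : ℂ) ^ (((r + 1 : ℝ) : ℂ) + α - 1) = ((x ^ (r + α) : ℝ) : ℂ) := by
    rw [Complex.ofReal_cpow hx.le]
    push_cast
    ring_nf
  rw [← Complex.ofReal_inj, hL, h, hexp]
  have hΓ' : ((Real.Gamma (r + α + 1) : ℝ) : ℂ) ≠ 0 := by exact_mod_cast hΓ
  rw [Complex.ofReal_mul, Complex.ofReal_div, Complex.ofReal_mul]
  congr 1
  rw [eq_div_iff hΓ', mul_comm (Complex.betaIntegral _ _), ← h2, mul_comm]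

/-- The Volterra equation satisfied by `x ↦ E_α(-K x^α)`. -/
lemma mittagLeffler_volterra {α K x : ℝ} (hα : 0 < α) (hK : 0 ≤ K) (hx : 0 ≤ x) :
    mittagLeffler α (-(K * x ^ α)) =
      1 - K / Real.Gamma α *
        ∫ s in (0 : ℝ)..x, (x - s) ^ (α - 1) * mittagLeffler α (-(K * s ^ α)) := by
  have hΓα : 0 < Real.Gamma α := Real.Gamma_pos_of_pos hα
  set B : ℕ → ℝ := fun k => (K * x ^ α) ^ k / Real.Gamma (α * k + 1) with hB
  have hBs : Summable B := summable_mittagLeffler hα _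
  have hsum : HasSum
      (fun k : ℕ => ∫ s in (0 : ℝ)..x,
        (x - s) ^ (α - 1) * ((-(K * s ^ α)) ^ k / Real.Gamma (α * k + 1)))
      (∫ s in (0 : ℝ)..x, (x - s) ^ (α - 1) * mittagLeffler α (-(K * s ^ α))) := by
    have hpc : Continuous fun s : ℝ => s ^ α := continuous_id.rpow_const fun _ => Or.inr hα.le
    refine intervalIntegral.hasSum_integral_of_dominated_convergence
      (fun k s => (x - s) ^ (α - 1) * B k) (fun k => ?_) (fun k => ?_) ?_ ?_ ?_
    · exact (((measurable_const.sub measurable_id).pow_const _).mul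
        ((((hpc.measurable.const_mul K).neg).pow_const k).div_const _)).aestronglyMeasurable
    · refine Filter.Eventually.of_forall fun s hs => ?_
      rw [uIoc_of_le hx] at hs
      have hΓ : 0 < Real.Gamma (α * k + 1) := Real.Gamma_pos_of_pos (by positivity)
      have h1 : 0 ≤ (x - s) ^ (α - 1) := Real.rpow_nonneg (by linarith [hs.2]) _
      have hs0 := hs.1.le
      rw [norm_mul, norm_div, norm_pow, norm_neg, Real.norm_of_nonneg hΓ.le,
        Real.norm_of_nonneg h1, Real.norm_of_nonneg (mul_nonneg hK (Real.rpow_nonneg hs.1.le _))]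
      simp only [hB]
      gcongr
      exact hs.2
    · exact Filter.Eventually.of_forall fun s _ => hBs.mul_left _
    · simp_rw [tsum_mul_left]
      exact (intervalIntegrable_kernel hα x 0 x).mul_const _
    · exact Filter.Eventually.of_forall fun s _ => (summable_mittagLeffler hα _).hasSum.mul_left _
  have hterm : ∀ k : ℕ, -(K / Real.Gamma α) * ∫ s in (0 : ℝ)..x,
        (x - s) ^ (α - 1) * ((-(K * s ^ α)) ^ k / Real.Gamma (α * k + 1)) =
      (-(K * x ^ α)) ^ (k + 1) / Real.Gamma (α * ((k + 1 : ℕ) : ℝ) + 1) := by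
    intro k
    have hΓ : 0 < Real.Gamma (α * k + 1) := Real.Gamma_pos_of_pos (by positivity)
    have hcong : ∫ s in (0 : ℝ)..x,
        (x - s) ^ (α - 1) * ((-(K * s ^ α)) ^ k / Real.Gamma (α * k + 1)) =
        ((-K) ^ k / Real.Gamma (α * k + 1)) *
          ∫ s in (0 : ℝ)..x, (x - s) ^ (α - 1) * s ^ (α * k) := by
      rw [← intervalIntegral.integral_const_mul]
      refine intervalIntegral.integral_congr fun s hs => ?_
      rw [uIcc_of_le hx] at hs
      rw [Real.rpow_mul hs.1, Real.rpow_natCast, ← neg_mul, mul_pow]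
      ring
    have hpow : x ^ (α * k + α) = (x ^ α) ^ (k + 1) := by
      rw [← Real.rpow_natCast, ← Real.rpow_mul hx]
      push_cast
      ring_nf
    rw [hcong, integral_kernel_mul_rpow hα (by positivity) hx, hpow,
      show α * ((k + 1 : ℕ) : ℝ) + 1 = α * k + α + 1 by push_cast; ring, ← neg_mul, mul_pow]
    field_simp
    ring
  have htail := hsum.mul_left (-(K / Real.Gamma α))
  simp_rw [hterm] at htail
  rw [mittagLeffler, (summable_mittagLeffler hα _).tsum_eq_zero_add, htail.tsum_eq]
  simp
  ring

lemma mittagLeffler_zero {α : ℝ} (hα : 0 < α) : mittagLeffler α 0 = 1 := by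
  simpa using mittagLeffler_volterra (K := 0) (x := 0) hα le_rfl le_rfl

lemma monotoneOn_rpow_mul_one {α : ℝ} (hα : α ≤ 1) (L : ℝ) :
    MonotoneOn (fun t : ℝ => t ^ (1 - α) * 1) (Icc 0 L) := fun x hx y _ hxy => by
  simpa using Real.rpow_le_rpow hx.1 hxy (by linarith)

lemma mittagLeffler_comp_pos {α K : ℝ} (hα : α ∈ Ioo (0 : ℝ) 1) (hK : 0 ≤ K) {x : ℝ}
    (hx : 0 ≤ x) : 0 < mittagLeffler α (-(K * x ^ α)) := by
  have hΓ := Real.Gamma_pos_of_pos hα.1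
  refine volterra_pos (K := K / Real.Gamma α) (c := fun _ => K / Real.Gamma α)
    (h := fun _ => 1) (L := x) hα continuousOn_const
    (fun _ _ => ⟨by positivity, le_rfl⟩) (continuousOn_mittagLeffler_comp hα.1 hK x) one_pos
    (monotoneOn_rpow_mul_one hα.2.le x) (fun t ht => ?_) x ⟨hx, le_rfl⟩
  rw [mittagLeffler_volterra hα.1 hK ht.1, ← intervalIntegral.integral_const_mul]
  congr 2
  ext s
  ring

/-- `x ↦ E_α(-K x^α)` is nonincreasing on `[0, ∞)`. -/
lemma mittagLeffler_comp_antitone {α K : ℝ} (hα : α ∈ Ioo (0 : ℝ) 1) (hK : 0 ≤ K) {x y : ℝ}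
    (hx : 0 ≤ x) (hxy : x ≤ y) :
    mittagLeffler α (-(K * y ^ α)) ≤ mittagLeffler α (-(K * x ^ α)) := by
  have hΓ := Real.Gamma_pos_of_pos hα.1
  rcases hK.eq_or_lt with rfl | hK
  · simp
  rcases hxy.eq_or_lt with rfl | hxy
  · rfl
  set e : ℝ → ℝ := fun x => mittagLeffler α (-(K * x ^ α)) with he
  have hec : ∀ L, ContinuousOn e (Icc 0 L) := continuousOn_mittagLeffler_comp hα.1 hK.le
  have hepos : ∀ s, 0 ≤ s → 0 < e s := fun s hs => mittagLeffler_comp_pos hα hK.le hs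
  have heq : ∀ s, 0 ≤ s →
      e s = 1 - K / Real.Gamma α * ∫ r in (0 : ℝ)..s, (s - r) ^ (α - 1) * e r :=
    fun s hs => mittagLeffler_volterra hα.1 hK.le hs
  set τ : ℝ := y - x with hτ
  have hτ0 : 0 < τ := sub_pos.2 hxy
  have hshift : ContinuousOn (fun t => e (t + τ)) (Icc 0 x) :=
    (hec (x + τ)).comp (by fun_prop) fun t ht => ⟨by linarith [ht.1], by linarith [ht.2]⟩
  have hp : ∀ t, 0 ≤ t →
      IntervalIntegrable (fun s : ℝ => (t + τ - s) ^ (α - 1) * e s) volume 0 τ :=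
    fun t _ => intervalIntegrable_kernel_mul hα.1 _ hτ0.le (hec τ)
  have main := volterra_pos (K := K / Real.Gamma α) (c := fun _ => K / Real.Gamma α)
    (u := fun t => e t - e (t + τ)) (L := x)
    (h := fun t => K / Real.Gamma α * ∫ s in (0 : ℝ)..τ, (t + τ - s) ^ (α - 1) * e s)
    hα continuousOn_const (fun _ _ => ⟨by positivity, le_rfl⟩) ((hec x).sub hshift) ?_ ?_ ?_
    x ⟨hx, le_rfl⟩
  · simp only [hτ, add_sub_cancel] at main
    exact (sub_pos.1 main).le
  · refine mul_pos (by positivity) (intervalIntegral.intervalIntegral_pos_of_pos_on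
      (hp 0 le_rfl) (fun s hs => ?_) hτ0)
    exact mul_pos (Real.rpow_pos_of_pos (by linarith [hs.2]) _) (hepos s hs.1.le)
  · intro t ht t' ht' htt'
    have hmul : ∀ t, t ^ (1 - α) *
        (K / Real.Gamma α * ∫ s in (0 : ℝ)..τ, (t + τ - s) ^ (α - 1) * e s) =
        K / Real.Gamma α * ∫ s in (0 : ℝ)..τ, t ^ (1 - α) * ((t + τ - s) ^ (α - 1) * e s) := by
      intro t
      rw [intervalIntegral.integral_const_mul]
      ring
    simp only [hmul]
    refine mul_le_mul_of_nonneg_left ?_ (by positivity)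
    refine intervalIntegral.integral_mono_on_of_le_Ioo hτ0.le ((hp t ht.1).const_mul _)
      ((hp t' ht'.1).const_mul _) fun s hs => ?_
    rw [← mul_assoc, ← mul_assoc]
    refine mul_le_mul_of_nonneg_right ?_ (hepos s hs.1.le).le
    have hd : 0 < τ - s := by linarith [hs.2]
    have hrw : ∀ z, 0 ≤ z → z ^ (1 - α) * (z + τ - s) ^ (α - 1) =
        (z / (z + (τ - s))) ^ (1 - α) := by
      intro z hz
      rw [Real.div_rpow hz (by positivity), show α - 1 = -(1 - α) by ring, add_sub_assoc,
        Real.rpow_neg (by positivity), div_eq_mul_inv]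
    have ht0 := ht.1
    have ht0' := ht'.1
    rw [hrw t ht0, hrw t' ht0']
    refine Real.rpow_le_rpow (by positivity) ?_ (by linarith [hα.2])
    rw [div_le_div_iff₀ (by positivity) (by positivity)]
    nlinarith
  · intro t ht
    have ht0 := ht.1
    have hsplit : ∫ s in (0 : ℝ)..(t + τ), (t + τ - s) ^ (α - 1) * e s =
        (∫ s in (0 : ℝ)..τ, (t + τ - s) ^ (α - 1) * e s) +
          ∫ s in (0 : ℝ)..t, (t - s) ^ (α - 1) * e (s + τ) := by
      have h1 := intervalIntegral.integral_comp_add_right (a := 0) (b := t)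
        (fun s => (t + τ - s) ^ (α - 1) * e s) τ
      simp only [add_sub_add_right_eq_sub, zero_add] at h1
      rw [h1]
      exact (intervalIntegral.integral_add_adjacent_intervals (hp t ht0)
        (intervalIntegrable_kernel_mul hα.1 _ (by linarith)
          ((hec (t + τ)).mono (Icc_subset_Icc hτ0.le le_rfl)))).symm
    have hlin : ∫ s in (0 : ℝ)..t,
        (t - s) ^ (α - 1) * (K / Real.Gamma α * (e s - e (s + τ))) =
        K / Real.Gamma α * ((∫ s in (0 : ℝ)..t, (t - s) ^ (α - 1) * e s) -
          ∫ s in (0 : ℝ)..t, (t - s) ^ (α - 1) * e (s + τ)) := by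
      rw [← intervalIntegral.integral_sub (intervalIntegrable_kernel_mul hα.1 _ ht0 (hec t))
        (intervalIntegrable_kernel_mul hα.1 _ ht0
          (hshift.mono (Icc_subset_Icc le_rfl ht.2))), ← intervalIntegral.integral_const_mul]
      congr 1
      ext s
      ring
    rw [hlin, heq t ht0, heq (t + τ) (by positivity), hsplit]
    ring

/-- Associativity of convolution on `[0, t]` with the kernel `x ↦ x^(α-1)`. -/
lemma convolution_kernel_assoc {α t : ℝ} (hα : 0 < α) (ht : 0 ≤ t) {e w : ℝ → ℝ}
    (he : ContinuousOn e (Icc 0 t)) (hw : ContinuousOn w (Icc 0 t)) :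
    ∫ s in (0 : ℝ)..t, e (t - s) * ∫ r in (0 : ℝ)..s, (s - r) ^ (α - 1) * w r =
      ∫ r in (0 : ℝ)..t, (∫ s in (0 : ℝ)..(t - r), (t - r - s) ^ (α - 1) * e s) * w r := by
  set E : ℝ → ℝ := (Ioc 0 t).indicator fun s => e (t - s) with hE
  set W : ℝ → ℝ := (Ioc 0 t).indicator w with hW
  set k : ℝ → ℝ := (Ioc 0 t).indicator fun x => x ^ (α - 1) with hk
  have her : ContinuousOn (fun s => e (t - s)) (Icc 0 t) :=
    he.comp (by fun_prop) fun s hs => ⟨by linarith [hs.2], by linarith [hs.1]⟩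
  have hEi : Integrable E :=
    (integrable_indicator_iff measurableSet_Ioc).2
      ((her.integrableOn_compact isCompact_Icc).mono_set Ioc_subset_Icc_self)
  have hWi : Integrable W :=
    (integrable_indicator_iff measurableSet_Ioc).2
      ((hw.integrableOn_compact isCompact_Icc).mono_set Ioc_subset_Icc_self)
  have hki : Integrable k :=
    (integrable_indicator_iff measurableSet_Ioc).2
      ((intervalIntegrable_iff_integrableOn_Ioc_of_le ht).1
        (intervalIntegral.intervalIntegrable_rpow' (by linarith)))
  obtain ⟨C, hC⟩ := isCompact_Icc.exists_bound_of_continuousOn her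
  have hint : Integrable (Function.uncurry fun s r => E s * (W r * k (s - r)))
      (volume.prod volume) := by
    refine Integrable.bdd_mul (c := |C|)
      (hWi.convolution_integrand (ContinuousLinearMap.mul ℝ ℝ) hki)
      (f := fun p : ℝ × ℝ => E p.1)
      hEi.aestronglyMeasurable.comp_fst (Filter.Eventually.of_forall fun p => ?_)
    by_cases hp : p.1 ∈ Ioc 0 t
    · simp only [hE, indicator_of_mem hp]
      exact (hC _ (Ioc_subset_Icc_self hp)).trans (le_abs_self C)
    · simp [hE, indicator_of_notMem hp]
  have hswap := integral_integral_swap hint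
  have hleft : (fun s => ∫ r, E s * (W r * k (s - r))) = (Ioc 0 t).indicator
      fun s => e (t - s) * ∫ r in (0 : ℝ)..s, (s - r) ^ (α - 1) * w r := by
    ext s
    by_cases hs : s ∈ Ioc 0 t
    · rw [indicator_of_mem hs, integral_const_mul, hE, indicator_of_mem hs,
        intervalIntegral.integral_of_le hs.1.le, integral_Ioc_eq_integral_Ioo,
        ← integral_indicator measurableSet_Ioo]
      congr 2
      ext r
      by_cases hr : r ∈ Ioo 0 s
      · rw [indicator_of_mem hr, hW, hk,
          indicator_of_mem (show r ∈ Ioc 0 t from ⟨hr.1, hr.2.le.trans hs.2⟩),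
          indicator_of_mem (show s - r ∈ Ioc 0 t from
            ⟨by linarith [hr.2], by linarith [hr.1, hs.2]⟩), mul_comm]
      · rw [indicator_of_notMem hr]
        by_cases hr0 : 0 < r
        · have : k (s - r) = 0 := indicator_of_notMem
            (fun h => hr ⟨hr0, by linarith [h.1]⟩) _
          rw [this, mul_zero]
        · have : W r = 0 := indicator_of_notMem (fun h => hr0 h.1) _
          rw [this, zero_mul]
    · simp [hE, indicator_of_notMem hs]
  have hright : (fun r => ∫ s, E s * (W r * k (s - r))) = (Ioc 0 t).indicator
      fun r => (∫ s in (0 : ℝ)..(t - r), (t - r - s) ^ (α - 1) * e s) * w r := by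
    ext r
    by_cases hr : r ∈ Ioc 0 t
    · have hsub := intervalIntegral.integral_comp_sub_left (a := r) (b := t)
        (fun s => (t - r - s) ^ (α - 1) * e s) t
      rw [sub_self] at hsub
      rw [indicator_of_mem hr, ← hsub, intervalIntegral.integral_of_le hr.2,
        ← integral_mul_const, ← integral_indicator measurableSet_Ioc]
      congr 1
      ext s
      by_cases hs : s ∈ Ioc r t
      · rw [indicator_of_mem hs, hE, hW, hk, indicator_of_mem hr,
          indicator_of_mem (show s ∈ Ioc 0 t from ⟨hr.1.trans hs.1, hs.2⟩),
          indicator_of_mem (show s - r ∈ Ioc 0 t from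
            ⟨by linarith [hs.1], by linarith [hr.1, hs.2]⟩),
          show t - r - (t - s) = s - r by ring]
        ring
      · rw [indicator_of_notMem hs]
        by_cases hrs : r < s
        · have : E s = 0 := indicator_of_notMem (fun h => hs ⟨hrs, h.2⟩) _
          rw [this, zero_mul]
        · have : k (s - r) = 0 := indicator_of_notMem (fun h => hrs (by linarith [h.1])) _
          rw [this, mul_zero, mul_zero]
    · simp [hW, indicator_of_notMem hr]
  rw [hleft, hright, integral_indicator measurableSet_Ioc,
    integral_indicator measurableSet_Ioc] at hswap
  rwa [intervalIntegral.integral_of_le ht, intervalIntegral.integral_of_le ht]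

/-- Solutions of the scalar Volterra equation with nonnegative coefficient stay positive. -/
lemma scalar_volterra_pos {α L K : ℝ} (hα : α ∈ Ioo (0 : ℝ) 1) {c φ : ℝ → ℝ}
    (hc : ContinuousOn c (Icc 0 L)) (hcb : ∀ t ∈ Icc 0 L, c t ∈ Icc 0 K)
    (hφ : ContinuousOn φ (Icc 0 L))
    (heq : ∀ t ∈ Icc 0 L,
      φ t = 1 - 1 / Real.Gamma α * ∫ s in (0 : ℝ)..t, (t - s) ^ (α - 1) * (c s * φ s)) :
    ∀ t ∈ Icc 0 L, 0 < φ t := by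
  have hΓ := Real.Gamma_pos_of_pos hα.1
  refine volterra_pos (K := K / Real.Gamma α) (c := fun s => c s / Real.Gamma α)
    (h := fun _ => 1) hα (hc.div_const _)
    (fun t ht => ⟨div_nonneg (hcb t ht).1 hΓ.le, by gcongr; exact (hcb t ht).2⟩) hφ one_pos
    (monotoneOn_rpow_mul_one hα.2.le L) fun t ht => ?_
  rw [heq t ht, ← intervalIntegral.integral_const_mul]
  congr 2
  ext s
  ring

lemma nonneg_of_integral_mono {L : ℝ} {u : ℝ → ℝ} (hu : ContinuousOn u (Icc 0 L))
    (hu0 : 0 ≤ u 0)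
    (hmono : MonotoneOn (fun t => ∫ s in (0 : ℝ)..t, u s) (Icc 0 L)) :
    ∀ t ∈ Icc 0 L, 0 ≤ u t := by
  intro T hT
  by_contra! hneg
  have hT0 : 0 < T := by
    rcases hT.1.lt_or_eq with h | h
    · exact h
    · rw [← h] at hneg; linarith
  have hev : ∀ᶠ s in nhdsWithin T (Icc 0 L), u s < 0 :=
    (hu T hT).eventually_lt_const hneg
  have hev2 : ∀ᶠ s in nhdsWithin T (Iio T), u s < 0 := by
    rw [← nhdsWithin_Ioo_eq_nhdsLT hT0]
    exact hev.filter_mono (nhdsWithin_mono _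
      (show Ioo 0 T ⊆ Icc 0 L from fun s hs => ⟨hs.1.le, hs.2.le.trans hT.2⟩))
  obtain ⟨l, hl, hsub⟩ := mem_nhdsLT_iff_exists_Ioo_subset.1 hev2
  have hl : l < T := hl
  set m := max l 0 with hm
  have hm0 : 0 ≤ m := le_max_right _ _
  have hmT : m < T := max_lt hl hT0
  have hint : ∀ x y, 0 ≤ x → x ≤ y → y ≤ L → IntervalIntegrable u volume x y :=
    fun x y hx hxy hy =>
      (hu.mono (by rw [uIcc_of_le hxy]; exact Icc_subset_Icc hx hy)).intervalIntegrable
  have h1 := hmono ⟨hm0, hmT.le.trans hT.2⟩ hT hmT.le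
  simp only at h1
  rw [← intervalIntegral.integral_add_adjacent_intervals
    (hint 0 m le_rfl hm0 (hmT.le.trans hT.2)) (hint m T hm0 hmT.le hT.2)] at h1
  have h2 := intervalIntegral.intervalIntegral_pos_of_pos_on (hint m T hm0 hmT.le hT.2).neg
    (fun s hs => neg_pos.2 (hsub (show s ∈ Ioo l T from
      ⟨(le_max_left _ _).trans_lt hs.1, hs.2⟩))) hmT
  simp only [Pi.neg_apply, intervalIntegral.integral_neg] at h2
  linarith

/-- Solutions of the scalar Volterra equation with coefficient at most `K` dominate
`E_α(-K t^α)`. -/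
lemma mittagLeffler_le_scalar_volterra {α L K : ℝ} (hα : α ∈ Ioo (0 : ℝ) 1) {c φ : ℝ → ℝ}
    (hc : ContinuousOn c (Icc 0 L)) (hcb : ∀ t ∈ Icc 0 L, c t ∈ Icc 0 K)
    (hφ : ContinuousOn φ (Icc 0 L))
    (heq : ∀ t ∈ Icc 0 L,
      φ t = 1 - 1 / Real.Gamma α * ∫ s in (0 : ℝ)..t, (t - s) ^ (α - 1) * (c s * φ s)) :
    ∀ t ∈ Icc 0 L, mittagLeffler α (-(K * t ^ α)) ≤ φ t := by
  intro T hT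
  have hΓ := Real.Gamma_pos_of_pos hα.1
  have hK : 0 ≤ K := (hcb T hT).1.trans (hcb T hT).2
  have hφpos := scalar_volterra_pos hα hc hcb hφ heq
  rcases hK.eq_or_lt with rfl | hK
  · have hzero : ∫ s in (0 : ℝ)..T, (T - s) ^ (α - 1) * (c s * φ s) = 0 := by
      refine (intervalIntegral.integral_congr (g := fun _ => 0) fun s hs => ?_).trans (by simp)
      rw [uIcc_of_le hT.1] at hs
      have := hcb s ⟨hs.1, hs.2.trans hT.2⟩
      simp [le_antisymm this.2 this.1]
    rw [heq T hT, hzero]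
    simp [mittagLeffler_zero hα.1]
  set e : ℝ → ℝ := fun x => mittagLeffler α (-(K * x ^ α)) with he
  have hec : ∀ L, ContinuousOn e (Icc 0 L) := continuousOn_mittagLeffler_comp hα.1 hK.le
  have heeq : ∀ s, 0 ≤ s →
      e s = 1 - K / Real.Gamma α * ∫ r in (0 : ℝ)..s, (s - r) ^ (α - 1) * e r :=
    fun s hs => mittagLeffler_volterra hα.1 hK.le hs
  have he0 : e 0 = 1 := by simpa using heeq 0 le_rfl
  have heanti : ∀ x y, 0 ≤ x → x ≤ y → e y ≤ e x := fun x y hx hxy =>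
    mittagLeffler_comp_antitone hα hK.le hx hxy
  set f : ℝ → ℝ := fun s => (K - c s) * φ s with hf
  have hfc : ContinuousOn f (Icc 0 L) := (continuousOn_const.sub hc).mul hφ
  have hfpos : ∀ s ∈ Icc 0 L, 0 ≤ f s := fun s hs =>
    mul_nonneg (sub_nonneg.2 (hcb s hs).2) (hφpos s hs).le
  set u : ℝ → ℝ := fun s => φ s - e s with hu
  have huc : ContinuousOn u (Icc 0 L) := hφ.sub (hec L)
  have hwc : ContinuousOn (fun s => f s - K * u s) (Icc 0 L) :=
    hfc.sub (continuousOn_const.mul huc)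
  have hueq : ∀ s ∈ Icc 0 L,
      u s = 1 / Real.Gamma α * ∫ r in (0 : ℝ)..s, (s - r) ^ (α - 1) * (f r - K * u r) := by
    intro s hs
    have hsub := Icc_subset_Icc (le_refl (0 : ℝ)) hs.2
    have hlin : ∫ r in (0 : ℝ)..s, (s - r) ^ (α - 1) * (f r - K * u r) =
        K * (∫ r in (0 : ℝ)..s, (s - r) ^ (α - 1) * e r) -
          ∫ r in (0 : ℝ)..s, (s - r) ^ (α - 1) * (c r * φ r) := by
      rw [← intervalIntegral.integral_const_mul, ← intervalIntegral.integral_sub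
        ((intervalIntegrable_kernel_mul hα.1 _ hs.1 (hec s)).const_mul _)
        (intervalIntegrable_kernel_mul hα.1 _ hs.1
          (q := fun r => c r * φ r) ((hc.mul hφ).mono hsub))]
      congr 1
      ext r
      simp only [hf, hu]
      ring
    rw [hlin]
    simp only [hu]
    rw [heq s hs, heeq s hs.1]
    ring
  have hrev : ∀ t, 0 ≤ t → ContinuousOn (fun r => e (t - r)) (Icc 0 t) := fun t _ =>
    (hec t).comp (by fun_prop) fun s hs => ⟨by linarith [hs.2], by linarith [hs.1]⟩
  have hii : ∀ {v : ℝ → ℝ} {x y : ℝ}, x ≤ y → ContinuousOn v (Icc x y) →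
      IntervalIntegrable v volume x y := fun hxy hv =>
    ContinuousOn.intervalIntegrable (by rwa [uIcc_of_le hxy])
  have hU : ∀ t ∈ Icc 0 L,
      K * ∫ s in (0 : ℝ)..t, u s = ∫ r in (0 : ℝ)..t, (1 - e (t - r)) * f r := by
    intro t ht
    have hsub := Icc_subset_Icc (le_refl (0 : ℝ)) ht.2
    have hassoc := convolution_kernel_assoc hα.1 ht.1 (hec t) (hwc.mono hsub)
    have hl : ∫ s in (0 : ℝ)..t, e (t - s) * (K * u s) = K / Real.Gamma α *
        ∫ s in (0 : ℝ)..t, e (t - s) *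
          ∫ r in (0 : ℝ)..s, (s - r) ^ (α - 1) * (f r - K * u r) := by
      rw [← intervalIntegral.integral_const_mul]
      refine intervalIntegral.integral_congr fun s hs => ?_
      rw [uIcc_of_le ht.1] at hs
      rw [hueq s (hsub hs)]
      ring
    have hr : ∫ r in (0 : ℝ)..t, (1 - e (t - r)) * (f r - K * u r) = K / Real.Gamma α *
        ∫ r in (0 : ℝ)..t, (∫ s in (0 : ℝ)..(t - r), (t - r - s) ^ (α - 1) * e s) *
          (f r - K * u r) := by
      rw [← intervalIntegral.integral_const_mul]
      refine intervalIntegral.integral_congr fun s hs => ?_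
      rw [uIcc_of_le ht.1] at hs
      rw [heeq (t - s) (by linarith [hs.2])]
      ring
    have hdiff : ∫ r in (0 : ℝ)..t, (1 - e (t - r)) * (f r - K * u r) =
        (∫ r in (0 : ℝ)..t, (1 - e (t - r)) * f r) - K * (∫ s in (0 : ℝ)..t, u s) +
          ∫ s in (0 : ℝ)..t, e (t - s) * (K * u s) := by
      have i1 := hii (v := fun r => (1 - e (t - r)) * f r) ht.1
        ((continuousOn_const (c := (1 : ℝ)).sub (hrev t ht.1)).mul
        (hfc.mono hsub))
      have i2 := (hii ht.1 (huc.mono hsub)).const_mul K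
      have i3 := hii (v := fun r => e (t - r) * (K * u r)) ht.1 ((hrev t ht.1).mul
        ((continuousOn_const (c := K)).mul (huc.mono hsub)))
      rw [← intervalIntegral.integral_const_mul, ← intervalIntegral.integral_sub i1 i2,
        ← intervalIntegral.integral_add (i1.sub i2) i3]
      congr 1
      ext r
      ring
    rw [hassoc, ← hr] at hl
    linarith
  have hmono : MonotoneOn (fun t => ∫ s in (0 : ℝ)..t, u s) (Icc 0 L) := by
    intro t ht t' ht' htt'
    refine le_of_mul_le_mul_left ?_ hK
    simp only
    rw [hU t ht, hU t' ht']
    have j1 : ContinuousOn (fun r => (1 - e (t' - r)) * f r) (Icc 0 t') :=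
      (continuousOn_const.sub (hrev t' ht'.1)).mul (hfc.mono (Icc_subset_Icc le_rfl ht'.2))
    have j1a := hii ht.1 (j1.mono (Icc_subset_Icc le_rfl htt'))
    have j1b := hii htt' (j1.mono (Icc_subset_Icc ht.1 le_rfl))
    rw [← intervalIntegral.integral_add_adjacent_intervals j1a j1b]
    have k1 : ∫ r in (0 : ℝ)..t, (1 - e (t - r)) * f r ≤
        ∫ r in (0 : ℝ)..t, (1 - e (t' - r)) * f r := by
      refine intervalIntegral.integral_mono_on ht.1
        (hii ht.1 ((continuousOn_const.sub (hrev t ht.1)).mul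
          (hfc.mono (Icc_subset_Icc le_rfl ht.2)))) j1a fun r hr => ?_
      refine mul_le_mul_of_nonneg_right ?_ (hfpos r ⟨hr.1, hr.2.trans ht.2⟩)
      linarith [heanti (t - r) (t' - r) (by linarith [hr.2]) (by linarith)]
    have k2 : 0 ≤ ∫ r in t..t', (1 - e (t' - r)) * f r := by
      refine intervalIntegral.integral_nonneg htt' fun r hr => ?_
      refine mul_nonneg ?_ (hfpos r ⟨ht.1.trans hr.1, hr.2.trans ht'.2⟩)
      linarith [heanti 0 (t' - r) le_rfl (by linarith [hr.2])]
    linarith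
  have hu0 : 0 ≤ u 0 := by
    have := heq 0 ⟨le_rfl, hT.1.trans hT.2⟩
    simp only [intervalIntegral.integral_same, mul_zero, sub_zero] at this
    simp [hu, he0, this]
  exact sub_nonneg.1 (nonneg_of_integral_mono huc hu0 hmono T hT)

lemma scalar_volterra_le_one {α L K : ℝ} (hα : α ∈ Ioo (0 : ℝ) 1) {c φ : ℝ → ℝ}
    (hc : ContinuousOn c (Icc 0 L)) (hcb : ∀ t ∈ Icc 0 L, c t ∈ Icc 0 K)
    (hφ : ContinuousOn φ (Icc 0 L))
    (heq : ∀ t ∈ Icc 0 L,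
      φ t = 1 - 1 / Real.Gamma α * ∫ s in (0 : ℝ)..t, (t - s) ^ (α - 1) * (c s * φ s)) :
    ∀ t ∈ Icc 0 L, φ t ≤ 1 := by
  intro t ht
  have hΓ := Real.Gamma_pos_of_pos hα.1
  have hφpos := scalar_volterra_pos hα hc hcb hφ heq
  rw [heq t ht, sub_le_self_iff]
  refine mul_nonneg (by positivity) (intervalIntegral.integral_nonneg ht.1 fun s hs => ?_)
  have hsI : s ∈ Icc 0 L := ⟨hs.1, hs.2.trans ht.2⟩
  exact mul_nonneg (Real.rpow_nonneg (by linarith [hs.2]) _)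
    (mul_nonneg (hcb s hsI).1 (hφpos s hsI).le)

/-- Solutions of the scalar Volterra equation depend linearly on the constant forcing term. -/
lemma scalar_volterra_const {α L K η : ℝ} (hα : α ∈ Ioo (0 : ℝ) 1) {c φ y : ℝ → ℝ}
    (hc : ContinuousOn c (Icc 0 L)) (hcb : ∀ t ∈ Icc 0 L, c t ∈ Icc 0 K)
    (hφ : ContinuousOn φ (Icc 0 L)) (hy : ContinuousOn y (Icc 0 L))
    (heq : ∀ t ∈ Icc 0 L,
      φ t = 1 - 1 / Real.Gamma α * ∫ s in (0 : ℝ)..t, (t - s) ^ (α - 1) * (c s * φ s))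
    (hyeq : ∀ t ∈ Icc 0 L,
      y t = η - 1 / Real.Gamma α * ∫ s in (0 : ℝ)..t, (t - s) ^ (α - 1) * (c s * y s)) :
    ∀ t ∈ Icc 0 L, y t = η * φ t := by
  intro t ht
  by_contra hne
  have hz : y t - η * φ t ≠ 0 := sub_ne_zero.2 hne
  have hpos : ∀ n : ℝ, 0 < φ t + n * (y t - η * φ t) := by
    intro n
    refine scalar_volterra_pos (φ := fun s => φ s + n * (y s - η * φ s)) hα hc hcb
      (hφ.add (continuousOn_const.mul (hy.sub (continuousOn_const.mul hφ)))) (fun s hs => ?_) t ht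
    have hsub := Icc_subset_Icc (le_refl (0 : ℝ)) hs.2
    have i1 : IntervalIntegrable (fun r => (s - r) ^ (α - 1) * (c r * φ r)) volume 0 s :=
      intervalIntegrable_kernel_mul hα.1 _ hs.1 (hc.mul hφ |>.mono hsub)
    have i2 : IntervalIntegrable (fun r => (s - r) ^ (α - 1) * (c r * y r)) volume 0 s :=
      intervalIntegrable_kernel_mul hα.1 _ hs.1 (hc.mul hy |>.mono hsub)
    have hlin : ∫ r in (0 : ℝ)..s, (s - r) ^ (α - 1) * (c r * (φ r + n * (y r - η * φ r))) =
        (1 - n * η) * (∫ r in (0 : ℝ)..s, (s - r) ^ (α - 1) * (c r * φ r)) +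
          n * ∫ r in (0 : ℝ)..s, (s - r) ^ (α - 1) * (c r * y r) := by
      rw [← intervalIntegral.integral_const_mul, ← intervalIntegral.integral_const_mul,
        ← intervalIntegral.integral_add (i1.const_mul _) (i2.const_mul _)]
      congr 1
      ext r
      ring
    rw [hlin, heq s hs, hyeq s hs]
    ring
  have h := hpos (-φ t / (y t - η * φ t))
  rw [div_mul_cancel₀ _ hz] at h
  linarith

/-- The matrix coefficient `X ↦ ⟪u, X v⟫` as a continuous linear functional. -/
noncomputable def matrixCoeff {d : ℕ} (u v : EuclideanSpace ℝ (Fin d)) :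
    Matrix (Fin d) (Fin d) ℝ →L[ℝ] ℝ :=
  LinearMap.toContinuousLinearMap
    { toFun := fun X => inner ℝ u (Matrix.toEuclideanCLM (𝕜 := ℝ) X v)
      map_add' := fun X Y => by simp [inner_add_right]
      map_smul' := fun r X => by simp [inner_smul_right] }

lemma matrixCoeff_apply {d : ℕ} (u v : EuclideanSpace ℝ (Fin d))
    (X : Matrix (Fin d) (Fin d) ℝ) :
    matrixCoeff u v X = inner ℝ u (Matrix.toEuclideanCLM (𝕜 := ℝ) X v) := rfl

lemma matrixCoeff_eigenvector_mul {d : ℕ} {A : Matrix (Fin d) (Fin d) ℝ} (hA : A.IsHermitian)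
    (i : Fin d) (v : EuclideanSpace ℝ (Fin d)) (X : Matrix (Fin d) (Fin d) ℝ) :
    matrixCoeff (hA.eigenvectorBasis i) v (A * X) =
      hA.eigenvalues i * matrixCoeff (hA.eigenvectorBasis i) v X := by
  have hself : ContinuousLinearMap.adjoint (Matrix.toEuclideanCLM (𝕜 := ℝ) A) =
      Matrix.toEuclideanCLM (𝕜 := ℝ) A := by
    rw [← ContinuousLinearMap.star_eq_adjoint, ← map_star, Matrix.star_eq_conjTranspose, hA.eq]
  have heig : Matrix.toEuclideanCLM (𝕜 := ℝ) A (hA.eigenvectorBasis i) =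
      hA.eigenvalues i • hA.eigenvectorBasis i := by
    apply (WithLp.ofLp_injective 2)
    rw [Matrix.ofLp_toEuclideanCLM, hA.mulVec_eigenvectorBasis]
    rfl
  rw [matrixCoeff_apply, matrixCoeff_apply, map_mul, mul_apply_eq_comp,
    ← ContinuousLinearMap.adjoint_inner_left, hself, heig, real_inner_smul_left]

/-- Matrix coefficients of a solution against an eigenvector of `A` solve a scalar equation. -/
lemma matrixCoeff_volterra {d : ℕ} {α a b : ℝ} (hα : 0 < α)
    {A : Matrix (Fin d) (Fin d) ℝ} (hA : A.IsHermitian) {g : ℝ → ℝ}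
    (hg : ContinuousOn g (Icc a b)) {Ψ : ℝ → Matrix (Fin d) (Fin d) ℝ}
    (hΨc : ContinuousOn Ψ (Icc a b))
    (hΨ : ∀ t ∈ Icc a b,
      Ψ t = 1 - (1 / Real.Gamma α) • ∫ s in a..t, (t - s) ^ (α - 1) • (g s • (A * Ψ s)))
    (i : Fin d) (v : EuclideanSpace ℝ (Fin d)) :
    ∀ t ∈ Icc 0 (b - a), matrixCoeff (hA.eigenvectorBasis i) v (Ψ (t + a)) =
      inner ℝ (hA.eigenvectorBasis i) v - 1 / Real.Gamma α * ∫ s in (0 : ℝ)..t, (t - s) ^ (α - 1) *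
        (hA.eigenvalues i * g (s + a) * matrixCoeff (hA.eigenvectorBasis i) v (Ψ (s + a))) := by
  intro t ht
  have htI : t + a ∈ Icc a b := ⟨by linarith [ht.1], by linarith [ht.2]⟩
  have hAΨ : ContinuousOn (fun s => g s • (A * Ψ s)) (Icc a (t + a)) :=
    (hg.smul (continuousOn_const.mul hΨc)).mono (Icc_subset_Icc le_rfl htI.2)
  rw [← uIcc_of_le htI.1] at hAΨ
  have hint := (intervalIntegrable_kernel hα (t + a) a (t + a)).smul_continuousOn hAΨ
  have hone : matrixCoeff (hA.eigenvectorBasis i) v 1 = inner ℝ (hA.eigenvectorBasis i) v := by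
    simp [matrixCoeff_apply]
  have hshift := intervalIntegral.integral_comp_add_right (a := 0) (b := t)
    (fun s => (t + a - s) ^ (α - 1) *
      (hA.eigenvalues i * g s * matrixCoeff (hA.eigenvectorBasis i) v (Ψ s))) a
  simp only [add_sub_add_right_eq_sub, zero_add] at hshift
  have hcomm : matrixCoeff (hA.eigenvectorBasis i) v
        (∫ s in a..t + a, (t + a - s) ^ (α - 1) • (g s • (A * Ψ s))) =
      ∫ s in a..t + a, matrixCoeff (hA.eigenvectorBasis i) v
        ((t + a - s) ^ (α - 1) • (g s • (A * Ψ s))) :=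
    (ContinuousLinearMap.intervalIntegral_comp_comm
      (matrixCoeff (hA.eigenvectorBasis i) v) hint).symm
  rw [hΨ _ htI, map_sub, map_smul, hone, hcomm, hshift, smul_eq_mul]
  congr 3
  ext s
  rw [map_smul, map_smul, matrixCoeff_eigenvector_mul, smul_eq_mul, smul_eq_mul]
  ring

/-- bounds `E_α(-λM(b-a)^α) ≤ ‖Ψ(t)‖ ≤ 1` for the solution of the matrix
Volterra equation `Ψ(t) = 𝕀 - (1/Γ(α)) ∫_a^t (t-s)^{α-1} g(s) A Ψ(s) ds`, where `A` is
symmetric positive semidefinite with largest eigenvalue `λ` and `0 ≤ g ≤ M`. -/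
theorem caputo_transition_matrix_bounds_psd
    (d : ℕ) (α a b M lam : ℝ) (hα : α ∈ Set.Ioo (0:ℝ) 1) (hab : a < b)
    (A : Matrix (Fin d) (Fin d) ℝ) (hA : A.PosSemidef)
    (hlam_mem : ∃ i, (hA.1).eigenvalues i = lam)
    (hlam_max : ∀ i, (hA.1).eigenvalues i ≤ lam)
    (hM : 0 ≤ M) (g : ℝ → ℝ) (hg : ContinuousOn g (Set.Icc a b))
    (hgb : ∀ t ∈ Set.Icc a b, g t ∈ Set.Icc 0 M)
    (Ψ : ℝ → Matrix (Fin d) (Fin d) ℝ) (hΨc : ContinuousOn Ψ (Set.Icc a b))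
    (hΨ : ∀ t ∈ Set.Icc a b,
      Ψ t = 1 - (1 / Real.Gamma α) • ∫ s in a..t, (t - s) ^ (α - 1) • (g s • (A * Ψ s))) :
    ∀ t ∈ Set.Icc a b,
      mittagLeffler α (-(lam * M * (b - a) ^ α)) ≤ ‖Matrix.toEuclideanCLM (𝕜 := ℝ) (Ψ t)‖ ∧
      ‖Matrix.toEuclideanCLM (𝕜 := ℝ) (Ψ t)‖ ≤ 1 := by
  intro t ht
  obtain ⟨i₀, hi₀⟩ := hlam_mem
  set B := (hA.1).eigenvectorBasis with hB
  have hmaps : MapsTo (fun x => x + a) (Icc 0 (b - a)) (Icc a b) := fun x hx =>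
    ⟨by linarith [hx.1], by linarith [hx.2]⟩
  have hc : ∀ i, ContinuousOn (fun x => (hA.1).eigenvalues i * g (x + a)) (Icc 0 (b - a)) :=
    fun i => continuousOn_const.mul (hg.comp (by fun_prop) hmaps)
  have hcb : ∀ i, ∀ x ∈ Icc 0 (b - a),
      (hA.1).eigenvalues i * g (x + a) ∈ Icc 0 ((hA.1).eigenvalues i * M) := fun i x hx =>
    ⟨mul_nonneg (hA.eigenvalues_nonneg i) (hgb _ (hmaps hx)).1,
      mul_le_mul_of_nonneg_left (hgb _ (hmaps hx)).2 (hA.eigenvalues_nonneg i)⟩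
  have hyc : ∀ i v, ContinuousOn (fun x => matrixCoeff (B i) v (Ψ (x + a))) (Icc 0 (b - a)) :=
    fun i v => (matrixCoeff (B i) v).continuous.comp_continuousOn
      (hΨc.comp (by fun_prop) hmaps)
  have hyeq := matrixCoeff_volterra hα.1 hA.1 hg hΨc hΨ
  have hφeq : ∀ i, ∀ x ∈ Icc 0 (b - a), matrixCoeff (B i) (B i) (Ψ (x + a)) =
      1 - 1 / Real.Gamma α * ∫ s in (0 : ℝ)..x, (x - s) ^ (α - 1) *
        ((hA.1).eigenvalues i * g (s + a) * matrixCoeff (B i) (B i) (Ψ (s + a))) := by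
    intro i x hx
    have h := hyeq i (B i) x hx
    rwa [← hB, real_inner_self_eq_norm_sq, B.norm_eq_one, one_pow] at h
  have hx : t - a ∈ Icc 0 (b - a) := ⟨by linarith [ht.1], by linarith [ht.2]⟩
  constructor
  · have hle := mittagLeffler_le_scalar_volterra hα (hc i₀) (hcb i₀) (hyc i₀ (B i₀)) (hφeq i₀)
      (t - a) hx
    have hlam : 0 ≤ lam := hi₀ ▸ hA.eigenvalues_nonneg i₀
    have hanti := mittagLeffler_comp_antitone hα (mul_nonneg hlam hM) hx.1 hx.2
    rw [hi₀, sub_add_cancel] at hle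
    refine (hanti.trans hle).trans ?_
    calc matrixCoeff (B i₀) (B i₀) (Ψ t)
        ≤ ‖B i₀‖ * ‖Matrix.toEuclideanCLM (𝕜 := ℝ) (Ψ t) (B i₀)‖ := by
          rw [matrixCoeff_apply]
          exact real_inner_le_norm _ _
      _ ≤ ‖B i₀‖ * (‖Matrix.toEuclideanCLM (𝕜 := ℝ) (Ψ t)‖ * ‖B i₀‖) := by
          gcongr
          exact ContinuousLinearMap.le_opNorm _ _
      _ = _ := by simp [B.norm_eq_one]
  · refine ContinuousLinearMap.opNorm_le_bound _ zero_le_one fun v => ?_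
    rw [one_mul]
    refine le_of_sq_le_sq ?_ (norm_nonneg _)
    rw [← B.sum_sq_norm_inner_right, ← B.sum_sq_norm_inner_right v]
    refine Finset.sum_le_sum fun i _ => ?_
    have h := scalar_volterra_const hα (hc i) (hcb i) (hyc i (B i)) (hyc i v) (hφeq i)
      (hyeq i v) (t - a) hx
    have hpos := scalar_volterra_pos hα (hc i) (hcb i) (hyc i (B i)) (hφeq i) (t - a) hx
    have hle := scalar_volterra_le_one hα (hc i) (hcb i) (hyc i (B i)) (hφeq i) (t - a) hx
    rw [sub_add_cancel] at h hpos hle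
    rw [← matrixCoeff_apply, h, norm_mul, Real.norm_of_nonneg hpos.le]
    gcongr
    exact mul_le_of_le_one_right (norm_nonneg _) hle
end

section
/- Let α ∈ (0,1), a < t₀ reals, let A be a real symmetric positive semidefinite d×d matrix with largest eigenvalue λ, let M ≥ 0 and let g : [a,t₀] → ℝ be continuous with 0 ≤ g(s) ≤ M for all s. Suppose Φ : [a,t₀) → ℝ^{d×d} satisfies Φ(τ) = (t₀−τ)^{α−1}/Γ(α) · 𝕀 − (1/Γ(α)) ∫_τ^{t₀} (s−τ)^{α−1} g(s) A Φ(s) ds for all τ ∈ [a,t₀), with τ ↦ (t₀−τ)^{1−α}Φ(τ) extending continuously to [a,t₀]. Then for every τ ∈ [a,t₀): E_{α,α}(−λ M (t₀−a)^α) ≤ ‖(t₀−τ)^{1−α} Φ(τ)‖ ≤ 1, where ‖·‖ is the operator norm induced by the Euclidean norm. -/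
open MeasureTheory Set Matrix

attribute [local instance] Matrix.normedAddCommGroup Matrix.normedSpace

/-- The two-parameter Mittag-Leffler function `E_{α,β}(x) = Σ_{k=0}^∞ x^k / Γ(αk+β)`. -/
noncomputable def mittagLeffler2 (α β x : ℝ) : ℝ :=
  ∑' k : ℕ, x ^ k / Real.Gamma (α * k + β)

open Filter Topology

section BetaKernel

lemma integral_sub_rpow_mul_rpow {a b t : ℝ} (ha : 0 < a) (hb : 0 < b) (ht : 0 < t) :
    ∫ s in (0 : ℝ)..t, (t - s) ^ (a - 1) * s ^ (b - 1) =
      t ^ (a + b - 1) * (Real.Gamma a * Real.Gamma b / Real.Gamma (a + b)) := by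
  have h := Complex.betaIntegral_scaled (b : ℂ) (a : ℂ) ht
  rw [Complex.betaIntegral_eq_Gamma_mul_div b a (by simpa) (by simpa)] at h
  rw [← Complex.ofReal_inj, ← intervalIntegral.integral_ofReal]
  have h1 : ∫ s in (0 : ℝ)..t, (((t - s) ^ (a - 1) * s ^ (b - 1) : ℝ) : ℂ) =
      ∫ x in (0 : ℝ)..t, (x : ℂ) ^ ((b : ℂ) - 1) * ((t : ℂ) - x) ^ ((a : ℂ) - 1) := by
    refine intervalIntegral.integral_congr fun x hx => ?_
    rw [uIcc_of_le ht.le] at hx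
    rw [Complex.ofReal_mul, Complex.ofReal_cpow (by linarith [hx.2]), Complex.ofReal_cpow hx.1]
    push_cast
    ring
  rw [h1, h]
  push_cast
  rw [Complex.ofReal_cpow ht.le, ← Complex.Gamma_ofReal, ← Complex.Gamma_ofReal,
    ← Complex.Gamma_ofReal]
  push_cast
  rw [add_comm (b : ℂ) a, mul_comm (Complex.Gamma b)]

lemma intervalIntegrable_sub_rpow_mul_rpow {a b t : ℝ} (ha : 0 < a) (hb : 0 < b) (ht : 0 < t) :
    IntervalIntegrable (fun s => (t - s) ^ (a - 1) * s ^ (b - 1)) volume 0 t := by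
  have key : ∀ {a b : ℝ}, 0 < b →
      IntervalIntegrable (fun s => (t - s) ^ (a - 1) * s ^ (b - 1)) volume 0 (t / 2) := by
    intro a b hb
    refine IntervalIntegrable.continuousOn_mul
      (intervalIntegral.intervalIntegrable_rpow' (by linarith)) ?_
    refine ContinuousOn.rpow_const (by fun_prop) fun x hx => Or.inl ?_
    rw [uIcc_of_le (by linarith)] at hx
    linarith [hx.2]
  refine (key hb).trans ?_
  have h := ((key (a := b) ha).comp_sub_left t).symm
  have e : t - t / 2 = t / 2 := by ring
  simp only [e, sub_zero, sub_sub_cancel] at h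
  exact h.congr (fun x _ => mul_comm _ _)

lemma intervalIntegrable_kernel_smul {E : Type*} [NormedAddCommGroup E] [NormedSpace ℝ E]
    {a b t : ℝ} (ha : 0 < a) (hb : 0 < b) (ht : 0 < t) {f : ℝ → E}
    (hf : ContinuousOn f (Icc 0 t)) :
    IntervalIntegrable (fun s => (t - s) ^ (a - 1) • s ^ (b - 1) • f s) volume 0 t := by
  have h := (intervalIntegrable_sub_rpow_mul_rpow ha hb ht).smul_continuousOn
    (f := fun s => (t - s) ^ (a - 1) * s ^ (b - 1)) (g := f) (by rwa [uIcc_of_le ht.le])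
  simpa only [mul_smul] using h

lemma intervalIntegrable_kernel_mul_s10 {a b t : ℝ} (ha : 0 < a) (hb : 0 < b) (ht : 0 < t)
    {f : ℝ → ℝ} (hf : ContinuousOn f (Icc 0 t)) :
    IntervalIntegrable (fun s => (t - s) ^ (a - 1) * (s ^ (b - 1) * f s)) volume 0 t :=
  intervalIntegrable_kernel_smul ha hb ht hf

end BetaKernel

/-- `u` is continuous on `[0, T]` and `x t = t ^ (α - 1) * u t` solves the scalar Volterra equation
`x t = b t ^ (α - 1) / Γ(α) - (1 / Γ(α)) ∫ s in 0..t, (t - s) ^ (α - 1) p s x s`. -/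
structure IsVolterraSolution (α T b : ℝ) (p u : ℝ → ℝ) : Prop where
  continuousOn : ContinuousOn u (Icc 0 T)
  eq : ∀ t ∈ Ioc 0 T, t ^ (α - 1) * u t =
    (b * t ^ (α - 1) - ∫ s in (0 : ℝ)..t, (t - s) ^ (α - 1) * (s ^ (α - 1) * (p s * u s))) /
      Real.Gamma α

namespace IsVolterraSolution

variable {α T b : ℝ} {p u : ℝ → ℝ}

lemma tendsto_integral_div (hα : 0 < α) (hT : 0 < T) {f : ℝ → ℝ} (hf : ContinuousOn f (Icc 0 T)) :
    Tendsto (fun t => (∫ s in (0 : ℝ)..t, (t - s) ^ (α - 1) * (s ^ (α - 1) * f s)) /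
      t ^ (α - 1)) (𝓝[>] 0) (𝓝 0) := by
  obtain ⟨C, hC⟩ := isCompact_Icc.exists_bound_of_continuousOn hf
  set B := Real.Gamma α * Real.Gamma α / Real.Gamma (α + α)
  have hlim : Tendsto (fun t : ℝ => C * (t ^ α * B)) (𝓝[>] 0) (𝓝 0) := by
    have h : ContinuousAt (fun t : ℝ => C * (t ^ α * B)) 0 := by
      have := Real.continuousAt_rpow_const 0 α (Or.inr hα.le)
      fun_prop
    have h0 := h.tendsto
    simp only [Real.zero_rpow hα.ne', zero_mul, mul_zero] at h0
    exact h0.mono_left nhdsWithin_le_nhds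
  refine squeeze_zero_norm' ?_ hlim
  filter_upwards [Ioc_mem_nhdsGT hT] with t ht
  have hpos : 0 < t ^ (α - 1) := Real.rpow_pos_of_pos ht.1 _
  rw [norm_div, Real.norm_of_nonneg hpos.le, div_le_iff₀ hpos]
  have hb : ‖∫ s in (0 : ℝ)..t, (t - s) ^ (α - 1) * (s ^ (α - 1) * f s)‖ ≤
      ∫ s in (0 : ℝ)..t, C * ((t - s) ^ (α - 1) * s ^ (α - 1)) := by
    refine intervalIntegral.norm_integral_le_of_norm_le ht.1.le ?_
      ((intervalIntegrable_sub_rpow_mul_rpow hα hα ht.1).const_mul C)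
    refine Eventually.of_forall fun s hs => ?_
    have h1 : 0 ≤ (t - s) ^ (α - 1) := Real.rpow_nonneg (by linarith [hs.2]) _
    have h2 : 0 ≤ s ^ (α - 1) := Real.rpow_nonneg hs.1.le _
    rw [norm_mul, norm_mul, Real.norm_of_nonneg h1, Real.norm_of_nonneg h2, ← mul_assoc,
      mul_comm C]
    exact mul_le_mul_of_nonneg_left (hC s ⟨hs.1.le, hs.2.trans ht.2⟩) (mul_nonneg h1 h2)
  rw [intervalIntegral.integral_const_mul, integral_sub_rpow_mul_rpow hα hα ht.1] at hb
  refine hb.trans_eq ?_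
  rw [show α + α - 1 = α + (α - 1) by ring, Real.rpow_add ht.1]
  ring

lemma eq_div (h : IsVolterraSolution α T b p u) {t : ℝ} (ht : t ∈ Ioc 0 T) :
    u t = (b - (∫ s in (0 : ℝ)..t, (t - s) ^ (α - 1) * (s ^ (α - 1) * (p s * u s))) /
      t ^ (α - 1)) / Real.Gamma α := by
  have hpos : 0 < t ^ (α - 1) := Real.rpow_pos_of_pos ht.1 _
  have h1 := h.eq t ht
  have : u t = t ^ (α - 1) * u t / t ^ (α - 1) := by field_simp
  rw [this, h1]
  field_simp

lemma apply_zero (h : IsVolterraSolution α T b p u) (hα : 0 < α) (hT : 0 < T)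
    (hp : ContinuousOn p (Icc 0 T)) : u 0 = b / Real.Gamma α := by
  have h1 : Tendsto u (𝓝[>] 0) (𝓝 (u 0)) :=
    ((h.continuousOn 0 ⟨le_rfl, hT.le⟩).mono_of_mem_nhdsWithin (Icc_mem_nhdsGT hT)).tendsto
  have h2 := ((tendsto_integral_div hα hT (hp.mul h.continuousOn)).const_sub b).div_const
    (Real.Gamma α)
  rw [sub_zero] at h2
  refine tendsto_nhds_unique h1 (h2.congr' ?_)
  filter_upwards [Ioc_mem_nhdsGT hT] with t ht
  exact (h.eq_div ht).symm

lemma integral_div_rpow_mono (hα : 0 < α) (hα1 : α ≤ 1) {f : ℝ → ℝ} {r t : ℝ}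
    (hr : 0 < r) (hrt : r ≤ t) (hf : ContinuousOn f (Icc 0 t)) (hf0 : ∀ s ∈ Icc 0 t, 0 ≤ f s) :
    (∫ s in (0 : ℝ)..r, (t - s) ^ (α - 1) * (s ^ (α - 1) * f s)) / t ^ (α - 1) ≤
      (∫ s in (0 : ℝ)..r, (r - s) ^ (α - 1) * (s ^ (α - 1) * f s)) / r ^ (α - 1) := by
  have ht : 0 < t := hr.trans_le hrt
  rw [← intervalIntegral.integral_div, ← intervalIntegral.integral_div]
  refine intervalIntegral.integral_mono_on_of_le_Ioo hr.le ?_ ?_ fun s hs => ?_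
  · refine ((intervalIntegrable_kernel_mul_s10 hα hα ht hf).mono_set ?_).div_const _
    rw [uIcc_of_le hr.le, uIcc_of_le ht.le]
    exact Icc_subset_Icc_right hrt
  · exact (intervalIntegrable_kernel_mul_s10 hα hα hr
      (hf.mono (Icc_subset_Icc_right hrt))).div_const _
  · have hsr : 0 < r - s := by linarith [hs.2]
    have hst : 0 < t - s := by linarith
    have h1 : ((t - s) / t) ^ (α - 1) ≤ ((r - s) / r) ^ (α - 1) := by
      refine Real.rpow_le_rpow_of_nonpos (div_pos hsr hr) ?_ (by linarith)
      rw [div_le_div_iff₀ hr ht]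
      nlinarith [hs.1]
    rw [Real.div_rpow hst.le ht.le, Real.div_rpow hsr.le hr.le] at h1
    have h2 : 0 ≤ s ^ (α - 1) * f s :=
      mul_nonneg (Real.rpow_nonneg hs.1.le _) (hf0 s ⟨hs.1.le, by linarith⟩)
    rw [mul_div_right_comm, mul_div_right_comm]
    exact mul_le_mul_of_nonneg_right h1 h2

lemma exists_forall_integral_lt (hα : 0 < α) {t ε : ℝ} (ht : 0 < t) (hε : 0 < ε) :
    ∃ l ∈ Ioo 0 t, ∀ r ∈ Ico l t, ∫ s in r..t, (t - s) ^ (α - 1) * s ^ (α - 1) < ε := by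
  have hi := intervalIntegrable_sub_rpow_mul_rpow hα hα ht
  have hc := intervalIntegral.continuousOn_primitive_interval_left
    ((intervalIntegrable_iff' (by finiteness)).1 hi)
  rw [uIcc_of_le ht.le] at hc
  have h1 := ((hc t ⟨ht.le, le_rfl⟩).mono_of_mem_nhdsWithin (Icc_mem_nhdsLE ht)).mono
    Iio_subset_Iic_self
  have h2 : Tendsto (fun r => ∫ s in r..t, (t - s) ^ (α - 1) * s ^ (α - 1)) (𝓝[<] t) (𝓝 0) := by
    simpa using h1.tendsto
  obtain ⟨l, hl, hsub⟩ := mem_nhdsLT_iff_exists_Ico_subset.1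
    ((h2.eventually_lt_const hε).and (Ioo_mem_nhdsLT ht))
  exact ⟨l, (hsub ⟨le_rfl, hl⟩).2, fun r hr => (hsub hr).1⟩

theorem pos (h : IsVolterraSolution α T b p u) (hα : 0 < α) (hα1 : α ≤ 1) (hT : 0 < T)
    (hb : 0 < b) (hp : ContinuousOn p (Icc 0 T)) (hp0 : ∀ t ∈ Icc 0 T, 0 ≤ p t) :
    ∀ t ∈ Icc 0 T, 0 < u t := by
  by_contra! hcon
  have hΓ := Real.Gamma_pos_of_pos hα
  have hclosed : IsClosed (Icc 0 T ∩ u ⁻¹' Iic 0) :=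
    h.continuousOn.preimage_isClosed_of_isClosed isClosed_Icc isClosed_Iic
  obtain ⟨t, ⟨htT, hut⟩, hmin⟩ := (isCompact_Icc.of_isClosed_subset hclosed
    inter_subset_left).exists_isLeast hcon
  have hu0 : 0 < u 0 := by
    rw [h.apply_zero hα hT hp]
    positivity
  have ht : 0 < t := by
    rcases htT.1.eq_or_lt with h0 | h0
    · rw [← h0] at hut
      exact absurd hut (not_le.2 hu0)
    · exact h0
  have hpos : ∀ s ∈ Ico 0 t, 0 < u s := by
    intro s hs
    by_contra! hs0
    exact absurd (hmin ⟨⟨hs.1, hs.2.le.trans htT.2⟩, hs0⟩) (not_le.2 hs.2)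
  have hsub : Icc 0 t ⊆ Icc 0 T := Icc_subset_Icc_right htT.2
  have hut0 : 0 ≤ u t := by
    have hm : MapsTo u (Ico 0 t) (Ici 0) := fun s hs => (hpos s hs).le
    have hcl : t ∈ closure (Ico 0 t) := by
      rw [closure_Ico ht.ne]
      exact ⟨ht.le, le_rfl⟩
    have hw : ContinuousWithinAt u (Ico 0 t) t :=
      (h.continuousOn t htT).mono (Ico_subset_Icc_self.trans hsub)
    have := hw.mem_closure hcl hm
    rwa [isClosed_Ici.closure_eq] at this
  have hnonneg : ∀ s ∈ Icc 0 t, 0 ≤ u s := by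
    intro s hs
    rcases hs.2.eq_or_lt with h0 | h0
    · rwa [h0]
    · exact (hpos s ⟨hs.1, h0⟩).le
  have hpu : ContinuousOn (fun s => p s * u s) (Icc 0 t) := (hp.mul h.continuousOn).mono hsub
  obtain ⟨P, hP⟩ := isCompact_Icc.exists_bound_of_continuousOn hp
  have hP0 : 0 ≤ P := (norm_nonneg _).trans (hP t htT)
  have hk : 0 < t ^ (α - 1) := Real.rpow_pos_of_pos ht _
  obtain ⟨l, hl, hJ⟩ := exists_forall_integral_lt hα ht
    (ε := Real.Gamma α * t ^ (α - 1) / (P + 1)) (by positivity)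
  obtain ⟨r, hr, hmax⟩ := isCompact_Icc.exists_isMaxOn (nonempty_Icc.2 hl.2.le)
    (h.continuousOn.mono ((Icc_subset_Icc_left hl.1.le).trans hsub))
  have hur : 0 < u r := (hpos l ⟨hl.1.le, hl.2⟩).trans_le (hmax ⟨le_rfl, hl.2.le⟩)
  have hrt : r < t := by
    rcases hr.2.eq_or_lt with h0 | h0
    · rw [h0] at hur
      exact absurd hut (not_le.2 hur)
    · exact h0
  have hr0 : 0 < r := hl.1.trans_le hr.1
  have hi := intervalIntegrable_kernel_mul_s10 hα hα ht hpu
  have hi1 := hi.mono_set (c := 0) (d := r) (by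
    rw [uIcc_of_le hr0.le, uIcc_of_le ht.le]; exact Icc_subset_Icc_right hrt.le)
  have hi2 := hi.mono_set (c := r) (d := t) (by
    rw [uIcc_of_le hrt.le, uIcc_of_le ht.le]; exact Icc_subset_Icc_left hr0.le)
  have hle := integral_div_rpow_mono hα hα1 hr0 hrt.le hpu fun s hs =>
    mul_nonneg (hp0 s (hsub hs)) (hnonneg s hs)
  have htail : ∫ s in r..t, (t - s) ^ (α - 1) * (s ^ (α - 1) * (p s * u s)) ≤
      P * u r * ∫ s in r..t, (t - s) ^ (α - 1) * s ^ (α - 1) := by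
    rw [← intervalIntegral.integral_const_mul]
    refine intervalIntegral.integral_mono_on hrt.le hi2 ?_ fun s hs => ?_
    · refine ((intervalIntegrable_sub_rpow_mul_rpow hα hα ht).mono_set ?_).const_mul _
      rw [uIcc_of_le hrt.le, uIcc_of_le ht.le]
      exact Icc_subset_Icc_left hr0.le
    · have h1 : 0 ≤ (t - s) ^ (α - 1) := Real.rpow_nonneg (by linarith [hs.2]) _
      have h2 : 0 ≤ s ^ (α - 1) := Real.rpow_nonneg (hr0.le.trans hs.1) _
      have hs0 : s ∈ Icc 0 t := ⟨hr0.le.trans hs.1, hs.2⟩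
      have h3 : p s * u s ≤ P * u r :=
        mul_le_mul ((le_abs_self _).trans (hP s (hsub hs0))) (hmax ⟨hr.1.trans hs.1, hs.2⟩)
          (hnonneg s hs0) hP0
      rw [← mul_assoc, mul_comm (P * u r)]
      exact mul_le_mul_of_nonneg_left h3 (mul_nonneg h1 h2)
  have hJr := hJ r ⟨hr.1, hrt⟩
  have hsmall : P * (∫ s in r..t, (t - s) ^ (α - 1) * s ^ (α - 1)) <
      Real.Gamma α * t ^ (α - 1) := by
    rw [lt_div_iff₀ (by positivity)] at hJr
    have : 0 ≤ ∫ s in r..t, (t - s) ^ (α - 1) * s ^ (α - 1) := by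
      refine intervalIntegral.integral_nonneg hrt.le fun s hs => mul_nonneg ?_ ?_
      · exact Real.rpow_nonneg (by linarith [hs.2]) _
      · exact Real.rpow_nonneg (hr0.le.trans hs.1) _
    linarith
  have e1 := h.eq_div ⟨ht, htT.2⟩
  have e2 := h.eq_div ⟨hr0, hrt.le.trans htT.2⟩
  rw [eq_div_iff hΓ.ne'] at e1 e2
  rw [← intervalIntegral.integral_add_adjacent_intervals hi1 hi2, add_div] at e1
  have htail2 : (∫ s in r..t, (t - s) ^ (α - 1) * (s ^ (α - 1) * (p s * u s))) / t ^ (α - 1) <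
      u r * Real.Gamma α := by
    rw [div_lt_iff₀ hk]
    refine htail.trans_lt ?_
    calc P * u r * (∫ s in r..t, (t - s) ^ (α - 1) * s ^ (α - 1))
        = u r * (P * ∫ s in r..t, (t - s) ^ (α - 1) * s ^ (α - 1)) := by ring
      _ < u r * (Real.Gamma α * t ^ (α - 1)) := mul_lt_mul_of_pos_left hsmall hur
      _ = _ := by ring
  have hfin : u t * Real.Gamma α ≤ 0 := mul_nonpos_of_nonpos_of_nonneg hut hΓ.le
  linarith [mul_nonneg hut0 hΓ.le]

end IsVolterraSolution

section MittagLeffler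

lemma Gamma_div_Gamma_add_le {α x : ℝ} (hα : 0 < α) (hα1 : α < 1) (hx : 0 < x) :
    Real.Gamma x / Real.Gamma (x + α) ≤ (x + α) ^ (1 - α) / x := by
  have hxα : 0 < x + α := by linarith
  have hΓ := Real.Gamma_pos_of_pos hxα
  have h := Real.Gamma_mul_add_mul_le_rpow_Gamma_mul_rpow_Gamma (s := x + α) (t := x + α + 1)
    (a := α) (b := 1 - α) hxα (by linarith) hα (by linarith) (by ring)
  rw [show α * (x + α) + (1 - α) * (x + α + 1) = x + 1 by ring, Real.Gamma_add_one hx.ne',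
    Real.Gamma_add_one hxα.ne', Real.mul_rpow hxα.le hΓ.le, mul_left_comm, ← Real.rpow_add hΓ,
    add_sub_cancel, Real.rpow_one] at h
  rw [div_le_div_iff₀ hΓ hx]
  linarith

lemma tendsto_Gamma_div_Gamma_add {α : ℝ} (hα : 0 < α) (hα1 : α < 1) :
    Tendsto (fun x => Real.Gamma x / Real.Gamma (x + α)) atTop (𝓝 0) := by
  have hlim : Tendsto (fun x : ℝ => 2 * x ^ (-α)) atTop (𝓝 0) := by
    simpa using (tendsto_rpow_neg_atTop hα).const_mul 2
  refine squeeze_zero' ?_ ?_ hlim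
  · filter_upwards [eventually_gt_atTop 0] with x hx
    exact div_nonneg (Real.Gamma_pos_of_pos hx).le (Real.Gamma_pos_of_pos (by linarith)).le
  · filter_upwards [eventually_ge_atTop 1] with x hx
    have hx0 : 0 < x := by linarith
    refine (Gamma_div_Gamma_add_le hα hα1 hx0).trans ?_
    rw [div_le_iff₀ hx0]
    calc (x + α) ^ (1 - α) ≤ (2 * x) ^ (1 - α) :=
          Real.rpow_le_rpow (by linarith) (by linarith) (by linarith)
      _ = 2 ^ (1 - α) * x ^ (1 - α) := Real.mul_rpow (by norm_num) hx0.le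
      _ ≤ 2 * x ^ (1 - α) := by
          gcongr
          exact (Real.rpow_le_rpow_of_exponent_le (by norm_num) (by linarith)).trans_eq
            (Real.rpow_one 2)
      _ = 2 * x ^ (-α) * x := by
          rw [mul_assoc, ← Real.rpow_add_one hx0.ne', neg_add_eq_sub]

lemma summable_mittagLeffler2 {α : ℝ} (hα : 0 < α) (hα1 : α < 1) (x : ℝ) :
    Summable fun k : ℕ => x ^ k / Real.Gamma (α * k + α) := by
  have ht : Tendsto (fun k : ℕ => |x| * (Real.Gamma (α * k + α) / Real.Gamma (α * k + α + α)))
      atTop (𝓝 0) := by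
    have h1 : Tendsto (fun k : ℕ => α * k + α) atTop atTop :=
      tendsto_atTop_add_const_right _ _ (tendsto_natCast_atTop_atTop.const_mul_atTop hα)
    simpa using ((tendsto_Gamma_div_Gamma_add hα hα1).comp h1).const_mul |x|
  refine summable_of_ratio_norm_eventually_le (r := 1 / 2) (by norm_num) ?_
  filter_upwards [ht.eventually_le_const (show (0 : ℝ) < 1 / 2 by norm_num)] with k hk
  have h1 : 0 < Real.Gamma (α * k + α) := Real.Gamma_pos_of_pos (by positivity)
  have h2 : 0 < Real.Gamma (α * k + α + α) := Real.Gamma_pos_of_pos (by positivity)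
  push_cast
  rw [show α * ((k : ℝ) + 1) + α = α * k + α + α by ring, norm_div, norm_div, norm_pow, norm_pow,
    Real.norm_of_nonneg h1.le, Real.norm_of_nonneg h2.le, Real.norm_eq_abs]
  calc |x| ^ (k + 1) / Real.Gamma (α * k + α + α)
      = |x| * (Real.Gamma (α * k + α) / Real.Gamma (α * k + α + α)) *
          (|x| ^ k / Real.Gamma (α * k + α)) := by
        field_simp
        ring
    _ ≤ _ := mul_le_mul_of_nonneg_right hk (by positivity)

lemma continuous_mittagLeffler2 {α : ℝ} (hα : 0 < α) (hα1 : α < 1) :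
    Continuous (mittagLeffler2 α α) := by
  refine continuous_iff_continuousAt.2 fun x => ?_
  have h : ContinuousOn (mittagLeffler2 α α) (Metric.closedBall 0 (|x| + 1)) := by
    refine continuousOn_tsum (u := fun k : ℕ => (|x| + 1) ^ k / Real.Gamma (α * k + α))
      (fun k => by fun_prop) (summable_mittagLeffler2 hα hα1 _) fun k y hy => ?_
    have h1 : 0 < Real.Gamma (α * k + α) := Real.Gamma_pos_of_pos (by positivity)
    rw [norm_div, norm_pow, Real.norm_of_nonneg h1.le]
    gcongr
    simpa using hy
  refine h.continuousAt (Metric.closedBall_mem_nhds_of_mem ?_)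
  simp

lemma isVolterraSolution_mittagLeffler2 {α c T : ℝ} (hα : 0 < α) (hα1 : α < 1) (hc : 0 ≤ c) :
    IsVolterraSolution α T 1 (fun _ => c) fun t => mittagLeffler2 α α (-(c * t ^ α)) where
  continuousOn := by
    have h : Continuous fun t : ℝ => t ^ α := Real.continuous_rpow_const hα.le
    exact ((continuous_mittagLeffler2 hα hα1).comp (by fun_prop)).continuousOn
  eq t ht := by
    have hΓ := Real.Gamma_pos_of_pos hα
    have hGk : ∀ k : ℕ, 0 < Real.Gamma (α * k + α) := fun k =>
      Real.Gamma_pos_of_pos (by positivity)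
    have hR : 0 ≤ c * t ^ α := mul_nonneg hc (Real.rpow_nonneg ht.1.le _)
    have hsum := summable_mittagLeffler2 hα hα1 (c * t ^ α)
    have hint := intervalIntegrable_sub_rpow_mul_rpow hα hα ht.1
    have key := intervalIntegral.hasSum_integral_of_dominated_convergence (μ := volume)
      (a := 0) (b := t)
      (F := fun (k : ℕ) s => (t - s) ^ (α - 1) * (s ^ (α - 1) *
        (c * ((-(c * s ^ α)) ^ k / Real.Gamma (α * k + α)))))
      (f := fun s => (t - s) ^ (α - 1) * (s ^ (α - 1) * (c * mittagLeffler2 α α (-(c * s ^ α)))))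
      (fun (k : ℕ) s => ((t - s) ^ (α - 1) * s ^ (α - 1)) *
        (c * ((c * t ^ α) ^ k / Real.Gamma (α * k + α))))
      (fun k => by fun_prop)
      (fun k => Eventually.of_forall fun s hs => by
        rw [uIoc_of_le ht.1.le] at hs
        have h1 : 0 ≤ (t - s) ^ (α - 1) := Real.rpow_nonneg (by linarith [hs.2]) _
        have h2 : 0 ≤ s ^ (α - 1) := Real.rpow_nonneg hs.1.le _
        have h3 : 0 ≤ s ^ α := Real.rpow_nonneg hs.1.le _
        have h4 : s ^ α ≤ t ^ α := Real.rpow_le_rpow hs.1.le hs.2 hα.le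
        rw [← mul_assoc, norm_mul, norm_mul, norm_mul, norm_div, norm_pow, norm_neg,
          Real.norm_of_nonneg h1, Real.norm_of_nonneg h2, Real.norm_of_nonneg hc,
          Real.norm_of_nonneg (hGk k).le, Real.norm_of_nonneg (mul_nonneg hc h3)]
        have := hGk k
        gcongr)
      (Eventually.of_forall fun s _ => (hsum.mul_left c).mul_left _)
      (by simp_rw [tsum_mul_left]; exact hint.mul_const _)
      (Eventually.of_forall fun s _ =>
        (((summable_mittagLeffler2 hα hα1 _).hasSum.mul_left c).mul_left _).mul_left _)
    have hterm : ∀ k : ℕ, ∫ s in (0 : ℝ)..t, (t - s) ^ (α - 1) * (s ^ (α - 1) *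
        (c * ((-(c * s ^ α)) ^ k / Real.Gamma (α * k + α)))) =
        -(Real.Gamma α * t ^ (α - 1)) *
          ((-(c * t ^ α)) ^ (k + 1) / Real.Gamma (α * ((k + 1 : ℕ) : ℝ) + α)) := by
      intro k
      have hb : 0 < α * k + α := by positivity
      have h1 : ∫ s in (0 : ℝ)..t, (t - s) ^ (α - 1) * (s ^ (α - 1) *
          (c * ((-(c * s ^ α)) ^ k / Real.Gamma (α * k + α)))) =
          ∫ s in (0 : ℝ)..t, (c * (-c) ^ k / Real.Gamma (α * k + α)) *
            ((t - s) ^ (α - 1) * s ^ (α * k + α - 1)) := by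
        refine intervalIntegral.integral_congr_ae (Eventually.of_forall fun s hs => ?_)
        rw [uIoc_of_le ht.1.le] at hs
        rw [show α * (k : ℝ) + α - 1 = α * k + (α - 1) by ring, Real.rpow_add hs.1,
          Real.rpow_mul hs.1.le, Real.rpow_natCast, neg_mul_eq_neg_mul, mul_pow]
        ring
      rw [h1, intervalIntegral.integral_const_mul, integral_sub_rpow_mul_rpow hα hb ht.1,
        show α + (α * (k : ℝ) + α) - 1 = α * ((k + 1 : ℕ) : ℝ) + (α - 1) by push_cast; ring,
        Real.rpow_add ht.1, Real.rpow_mul ht.1.le, Real.rpow_natCast, neg_mul_eq_neg_mul c,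
        mul_pow, show α + (α * (k : ℝ) + α) = α * ((k + 1 : ℕ) : ℝ) + α by push_cast; ring]
      have := (hGk k).ne'
      have := (hGk (k + 1)).ne'
      field_simp
      ring
    simp_rw [hterm] at key
    have hs := (summable_mittagLeffler2 hα hα1 (-(c * t ^ α))).hasSum
    have hs1 := ((hasSum_nat_add_iff' 1).2 hs).mul_left (-(Real.Gamma α * t ^ (α - 1)))
    have he := key.unique hs1
    rw [he]
    simp only [Finset.range_one, Finset.sum_singleton, pow_zero, Nat.cast_zero, mul_zero, zero_add]
    rw [mittagLeffler2]
    field_simp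
    ring

end MittagLeffler

section CausalConvolution

open scoped Convolution

lemma convolution_eq_zero_of_nonpos {F G : ℝ → ℝ} (hF : ∀ s ≤ 0, F s = 0)
    (hG : ∀ s ≤ 0, G s = 0) {t : ℝ} (ht : t ≤ 0) :
    (F ⋆[ContinuousLinearMap.mul ℝ ℝ, volume] G) t = 0 := by
  rw [convolution_def]
  refine integral_eq_zero_of_ae (Eventually.of_forall fun s => ?_)
  simp only [ContinuousLinearMap.mul_apply', Pi.zero_apply]
  rcases le_or_gt s 0 with h | h
  · rw [hF s h, zero_mul]
  · rw [hG (t - s) (by linarith), mul_zero]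

lemma convolution_eq_intervalIntegral {F G f g : ℝ → ℝ} (hF : ∀ s ≤ 0, F s = 0)
    (hG : ∀ s ≤ 0, G s = 0) {t : ℝ} (ht : 0 ≤ t) (hFf : EqOn F f (Ioo 0 t))
    (hGg : EqOn G g (Ioo 0 t)) :
    (F ⋆[ContinuousLinearMap.mul ℝ ℝ, volume] G) t =
      ∫ s in (0 : ℝ)..t, f s * g (t - s) := by
  rw [convolution_def, intervalIntegral.integral_of_le ht, integral_Ioc_eq_integral_Ioo,
    ← integral_indicator measurableSet_Ioo]
  congr 1 with s
  simp only [ContinuousLinearMap.mul_apply']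
  by_cases hs : s ∈ Ioo 0 t
  · rw [indicator_of_mem hs, hFf hs, hGg ⟨by linarith [hs.2], by linarith [hs.1]⟩]
  · rw [indicator_of_notMem hs]
    rcases le_or_gt s 0 with h | h
    · rw [hF s h, zero_mul]
    · rw [hG (t - s) (by linarith [not_lt.1 fun h' => hs ⟨h, h'⟩]), mul_zero]

lemma ae_integral_integral_assoc {T : ℝ} {f g h : ℝ → ℝ} (hf : IntegrableOn f (Ioo 0 T))
    (hg : IntegrableOn g (Ioo 0 T)) (hh : IntegrableOn h (Ioo 0 T)) :
    ∀ᵐ t, t ∈ Ioo 0 T →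
      ∫ s in (0 : ℝ)..t, (∫ v in (0 : ℝ)..s, f v * g (s - v)) * h (t - s) =
        ∫ s in (0 : ℝ)..t, f s * ∫ v in (0 : ℝ)..(t - s), g v * h (t - s - v) := by
  have hz : ∀ φ : ℝ → ℝ, ∀ s ≤ 0, (Ioo 0 T).indicator φ s = 0 := fun φ s hs =>
    indicator_of_notMem (fun h' : s ∈ Ioo 0 T => not_lt.2 hs h'.1) _
  have he : ∀ φ : ℝ → ℝ, ∀ t ≤ T, EqOn ((Ioo 0 T).indicator φ) φ (Ioo 0 t) := fun φ t ht s hs =>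
    indicator_of_mem (show s ∈ Ioo 0 T from ⟨hs.1, hs.2.trans_le ht⟩) _
  have hF := hf.integrable_indicator measurableSet_Ioo
  have hG := hg.integrable_indicator measurableSet_Ioo
  have hH := hh.integrable_indicator measurableSet_Ioo
  have hN := hG.norm.integrable_convolution (ContinuousLinearMap.mul ℝ ℝ) hH.norm
  filter_upwards [hF.norm.ae_convolution_exists (ContinuousLinearMap.mul ℝ ℝ) hN] with t ht htT
  have key := convolution_assoc (ContinuousLinearMap.mul ℝ ℝ) (ContinuousLinearMap.mul ℝ ℝ)
    (ContinuousLinearMap.mul ℝ ℝ) (ContinuousLinearMap.mul ℝ ℝ) (fun x y z => mul_assoc x y z)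
    hF.aestronglyMeasurable hG.aestronglyMeasurable hH.aestronglyMeasurable
    (hF.ae_convolution_exists _ hG) (hG.norm.ae_convolution_exists _ hH.norm) ht
  rw [convolution_eq_intervalIntegral (fun s hs => convolution_eq_zero_of_nonpos (hz f) (hz g) hs)
      (hz h) htT.1.le (fun s hs => convolution_eq_intervalIntegral (hz f) (hz g) hs.1.le
        (he f s (hs.2.trans htT.2).le) (he g s (hs.2.trans htT.2).le)) (he h t htT.2.le),
    convolution_eq_intervalIntegral (hz f)
      (fun s hs => convolution_eq_zero_of_nonpos (hz g) (hz h) hs) htT.1.le (he f t htT.2.le)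
      (fun s hs => convolution_eq_intervalIntegral (hz g) (hz h) hs.1.le
        (he g s (hs.2.trans htT.2).le) (he h s (hs.2.trans htT.2).le))] at key
  exact key

end CausalConvolution

namespace IsVolterraSolution

variable {α T c : ℝ} {p u v : ℝ → ℝ}

lemma ae_eq_add_integral (hu : IsVolterraSolution α T 1 p u)
    (hv : IsVolterraSolution α T 1 (fun _ => c) v) (hα : 0 < α)
    (hT : 0 < T) (hp : ContinuousOn p (Icc 0 T)) :
    ∀ᵐ t, t ∈ Ioo 0 T → t ^ (α - 1) * u t = t ^ (α - 1) * v t +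
      ∫ s in (0 : ℝ)..t, (c - p s) * ((s ^ (α - 1) * u s) * ((t - s) ^ (α - 1) * v (t - s))) := by
  have hΓ := (Real.Gamma_pos_of_pos hα).ne'
  have hk : ∀ f : ℝ → ℝ, ContinuousOn f (Icc 0 T) →
      IntegrableOn (fun s => s ^ (α - 1) * f s) (Ioo 0 T) := by
    intro f hf
    have h := (intervalIntegral.intervalIntegrable_rpow' (a := 0) (b := T)
      (show -1 < α - 1 by linarith)).mul_continuousOn (g := f) (by rwa [uIcc_of_le hT.le])
    exact ((intervalIntegrable_iff_integrableOn_Ioc_of_le hT.le).1 h).mono_set Ioo_subset_Ioc_self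
  have hq := hk (fun s => p s * u s) (hp.mul hu.continuousOn)
  have hr := hk _ hv.continuousOn
  have h1 := hk (fun _ => 1) continuousOn_const
  simp only [mul_one] at h1
  filter_upwards [ae_integral_integral_assoc hq h1 hr] with t ht htT
  replace ht := ht htT
  have hsub : Icc 0 t ⊆ Icc 0 T := Icc_subset_Icc_right htT.2.le
  have huc := hu.continuousOn.mono hsub
  have hpc := hp.mono hsub
  have hvc : ContinuousOn (fun s => v (t - s)) (Icc 0 t) :=
    (hv.continuousOn.mono hsub).comp (by fun_prop)
      (fun s hs => ⟨by linarith [hs.2], by linarith [hs.1]⟩)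
  have comm : ∀ f : ℝ → ℝ, ∀ s : ℝ, ∫ w in (0 : ℝ)..s, f w * (s - w) ^ (α - 1) =
      ∫ w in (0 : ℝ)..s, (s - w) ^ (α - 1) * f w := fun f s => by simp_rw [mul_comm]
  have flip : ∀ s : ℝ, ∫ w in (0 : ℝ)..s, w ^ (α - 1) * ((s - w) ^ (α - 1) * v (s - w)) =
      ∫ w in (0 : ℝ)..s, (s - w) ^ (α - 1) * (w ^ (α - 1) * v w) := by
    intro s
    have := intervalIntegral.integral_comp_sub_left (a := 0) (b := s)
      (fun w => (s - w) ^ (α - 1) * (w ^ (α - 1) * v w)) s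
    simpa using this
  have eu : ∀ s ∈ Ioc 0 T, ∫ w in (0 : ℝ)..s, (s - w) ^ (α - 1) * (w ^ (α - 1) * (p w * u w)) =
      s ^ (α - 1) - Real.Gamma α * (s ^ (α - 1) * u s) := by
    intro s hs
    rw [hu.eq s hs]
    field_simp
    ring
  have ev : ∀ s ∈ Ioc 0 T, c * ∫ w in (0 : ℝ)..s, (s - w) ^ (α - 1) * (w ^ (α - 1) * v w) =
      s ^ (α - 1) - Real.Gamma α * (s ^ (α - 1) * v s) := by
    intro s hs
    have h := hv.eq s hs
    have hi : ∫ w in (0 : ℝ)..s, (s - w) ^ (α - 1) * (w ^ (α - 1) * (c * v w)) =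
        c * ∫ w in (0 : ℝ)..s, (s - w) ^ (α - 1) * (w ^ (α - 1) * v w) := by
      rw [← intervalIntegral.integral_const_mul]
      congr 1 with w
      ring
    rw [hi, eq_div_iff hΓ] at h
    linarith
  have i1 := intervalIntegrable_kernel_mul_s10 hα hα htT.1 hvc
  have i2 := intervalIntegrable_kernel_mul_s10 hα hα htT.1
    (f := fun s => u s * v (t - s)) (huc.mul hvc)
  have i3 := intervalIntegrable_kernel_mul_s10 hα hα htT.1
    (f := fun s => p s * u s * v (t - s)) ((hpc.mul huc).mul hvc)
  have i4 := intervalIntegrable_kernel_mul_s10 hα hα htT.1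
    (f := fun s => p s * u s) (hpc.mul huc)
  have l1 : ∫ s in (0 : ℝ)..t, (∫ w in (0 : ℝ)..s, w ^ (α - 1) * (p w * u w) * (s - w) ^ (α - 1)) *
      ((t - s) ^ (α - 1) * v (t - s)) =
      (∫ s in (0 : ℝ)..t, (t - s) ^ (α - 1) * (s ^ (α - 1) * v (t - s))) - Real.Gamma α *
        ∫ s in (0 : ℝ)..t, (t - s) ^ (α - 1) * (s ^ (α - 1) * (u s * v (t - s))) := by
    rw [← intervalIntegral.integral_const_mul, ← intervalIntegral.integral_sub i1 (i2.const_mul _)]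
    refine intervalIntegral.integral_congr_ae (Eventually.of_forall fun s hs => ?_)
    rw [uIoc_of_le htT.1.le] at hs
    rw [comm (fun w => w ^ (α - 1) * (p w * u w)), eu s ⟨hs.1, hs.2.trans htT.2.le⟩]
    ring
  have l2 : c * ∫ s in (0 : ℝ)..t, s ^ (α - 1) * (p s * u s) *
      ∫ w in (0 : ℝ)..(t - s), w ^ (α - 1) * ((t - s - w) ^ (α - 1) * v (t - s - w)) =
      (∫ s in (0 : ℝ)..t, (t - s) ^ (α - 1) * (s ^ (α - 1) * (p s * u s))) - Real.Gamma α *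
        ∫ s in (0 : ℝ)..t, (t - s) ^ (α - 1) * (s ^ (α - 1) * (p s * u s * v (t - s))) := by
    rw [← intervalIntegral.integral_const_mul, ← intervalIntegral.integral_const_mul,
      ← intervalIntegral.integral_sub i4 (i3.const_mul _), intervalIntegral.integral_of_le htT.1.le,
      intervalIntegral.integral_of_le htT.1.le, integral_Ioc_eq_integral_Ioo,
      integral_Ioc_eq_integral_Ioo]
    refine setIntegral_congr_fun measurableSet_Ioo fun s hs => ?_
    have := ev (t - s) ⟨by linarith [hs.2], by linarith [hs.1, htT.2]⟩
    rw [flip, mul_left_comm, this]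
    ring
  have l3 := ev t ⟨htT.1, htT.2.le⟩
  rw [← flip, show (∫ w in (0 : ℝ)..t, w ^ (α - 1) * ((t - w) ^ (α - 1) * v (t - w))) =
    ∫ s in (0 : ℝ)..t, (t - s) ^ (α - 1) * (s ^ (α - 1) * v (t - s)) by
      simp_rw [mul_left_comm]] at l3
  rw [eu t ⟨htT.1, htT.2.le⟩, ← ht, l1, mul_sub, l3] at l2
  have l4 : ∫ s in (0 : ℝ)..t, (c - p s) *
      ((s ^ (α - 1) * u s) * ((t - s) ^ (α - 1) * v (t - s))) =
      c * (∫ s in (0 : ℝ)..t, (t - s) ^ (α - 1) * (s ^ (α - 1) * (u s * v (t - s)))) -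
        ∫ s in (0 : ℝ)..t, (t - s) ^ (α - 1) * (s ^ (α - 1) * (p s * u s * v (t - s))) := by
    rw [← intervalIntegral.integral_const_mul, ← intervalIntegral.integral_sub (i2.const_mul _) i3]
    congr 1 with s
    ring
  rw [l4]
  refine mul_left_cancel₀ hΓ ?_
  linarith

theorem le_of_le (hu : IsVolterraSolution α T 1 p u)
    (hv : IsVolterraSolution α T 1 (fun _ => c) v) (hα : 0 < α) (hα1 : α ≤ 1) (hT : 0 < T)
    (hp : ContinuousOn p (Icc 0 T)) (hp0 : ∀ t ∈ Icc 0 T, 0 ≤ p t) (hpc : ∀ t ∈ Icc 0 T, p t ≤ c) :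
    ∀ t ∈ Icc 0 T, v t ≤ u t := by
  have hT0 : (0 : ℝ) ∈ Icc 0 T := ⟨le_rfl, hT.le⟩
  have hc : 0 ≤ c := (hp0 0 hT0).trans (hpc 0 hT0)
  have hu0 := hu.pos hα hα1 hT one_pos hp hp0
  have hv0 := hv.pos hα hα1 hT one_pos continuousOn_const fun _ _ => hc
  have hae : (fun t => max (v t) (u t)) =ᵐ[volume.restrict (Icc 0 T)] u := by
    rw [← restrict_Ioo_eq_restrict_Icc]
    refine (ae_restrict_iff' measurableSet_Ioo).2 ?_
    filter_upwards [hu.ae_eq_add_integral hv hα hT hp] with t ht htT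
    refine max_eq_right (le_of_mul_le_mul_left ?_ (Real.rpow_pos_of_pos htT.1 (α - 1)))
    rw [ht htT, le_add_iff_nonneg_right]
    refine intervalIntegral.integral_nonneg htT.1.le fun s hs => ?_
    have hsT : s ∈ Icc 0 T := ⟨hs.1, hs.2.trans htT.2.le⟩
    have htsT : t - s ∈ Icc 0 T := ⟨by linarith [hs.2], by linarith [hs.1, htT.2]⟩
    exact mul_nonneg (sub_nonneg.2 (hpc s hsT)) (mul_nonneg
      (mul_nonneg (Real.rpow_nonneg hsT.1 _) (hu0 s hsT).le)
      (mul_nonneg (Real.rpow_nonneg htsT.1 _) (hv0 _ htsT).le))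
  have h := Measure.eqOn_Icc_of_ae_eq volume hT.ne hae
    (hv.continuousOn.sup hu.continuousOn) hu.continuousOn
  exact fun t ht => max_eq_right_iff.1 (h ht)

lemma le_div_Gamma {α T b : ℝ} {p u : ℝ → ℝ} (h : IsVolterraSolution α T b p u) (hα : 0 < α)
    (hα1 : α ≤ 1) (hT : 0 < T) (hb : 0 < b) (hp : ContinuousOn p (Icc 0 T))
    (hp0 : ∀ t ∈ Icc 0 T, 0 ≤ p t) {t : ℝ} (ht : t ∈ Ioc 0 T) : u t ≤ b / Real.Gamma α := by
  rw [h.eq_div ht]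
  refine div_le_div_of_nonneg_right (sub_le_self b ?_) (Real.Gamma_pos_of_pos hα).le
  refine div_nonneg (intervalIntegral.integral_nonneg ht.1.le fun s hs => ?_)
    (Real.rpow_nonneg ht.1.le _)
  have hsT : s ∈ Icc 0 T := ⟨hs.1, hs.2.trans ht.2⟩
  exact mul_nonneg (Real.rpow_nonneg (by linarith [hs.2]) _)
    (mul_nonneg (Real.rpow_nonneg hs.1 _)
      (mul_nonneg (hp0 s hsT) (h.pos hα hα1 hT hb hp hp0 s hsT).le))

end IsVolterraSolution

lemma abs_le_mul_abs_of_forall_pos {E : Type*} [AddCommGroup E] [Module ℝ E] (ℓ β : E →ₗ[ℝ] ℝ)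
    {C : ℝ} (h : ∀ v, 0 < β v → 0 ≤ ℓ v ∧ ℓ v ≤ C * β v) {e : E} (he : 0 < β e) (v : E) :
    |ℓ v| ≤ C * |β v| := by
  have key : ∀ v, 0 ≤ β v → 0 ≤ ℓ v ∧ ℓ v ≤ C * β v := by
    intro v hv
    have hlim : ∀ f : E →ₗ[ℝ] ℝ, Tendsto (fun ε : ℝ => f (v + ε • e)) (𝓝[>] 0) (𝓝 (f v)) := by
      intro f
      have hc : Continuous fun ε : ℝ => f v + ε * f e := by fun_prop
      simpa using (hc.tendsto 0).mono_left nhdsWithin_le_nhds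
    have hε : ∀ᶠ ε : ℝ in 𝓝[>] 0, 0 < β (v + ε • e) := by
      filter_upwards [self_mem_nhdsWithin] with ε hε
      simp only [map_add, map_smul, smul_eq_mul]
      exact add_pos_of_nonneg_of_pos hv (mul_pos hε he)
    exact ⟨ge_of_tendsto (hlim ℓ) (hε.mono fun ε hε => (h _ hε).1),
      le_of_tendsto_of_tendsto (hlim ℓ) ((hlim β).const_mul C) (hε.mono fun ε hε => (h _ hε).2)⟩
  rcases le_total 0 (β v) with hv | hv
  · rw [abs_of_nonneg hv, abs_of_nonneg (key v hv).1]
    exact (key v hv).2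
  · have h1 := key (-v) (by simpa using hv)
    rw [map_neg, map_neg] at h1
    rw [abs_of_nonpos hv, abs_of_nonpos (by linarith [h1.1])]
    exact h1.2

/-- The bilinear form `X ↦ e ⬝ᵥ X *ᵥ w` as a continuous linear functional on matrices. -/
noncomputable def Matrix.dotMulVecCLM {d : ℕ} (e w : Fin d → ℝ) :
    Matrix (Fin d) (Fin d) ℝ →L[ℝ] ℝ :=
  LinearMap.toContinuousLinearMap
    { toFun := fun X => e ⬝ᵥ X *ᵥ w
      map_add' := fun X Y => by rw [add_mulVec, dotProduct_add]
      map_smul' := fun c X => by rw [smul_mulVec, dotProduct_smul, RingHom.id_apply] }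

@[simp]
lemma Matrix.dotMulVecCLM_apply {d : ℕ} (e w : Fin d → ℝ) (X : Matrix (Fin d) (Fin d) ℝ) :
    Matrix.dotMulVecCLM e w X = e ⬝ᵥ X *ᵥ w := rfl

lemma isVolterraSolution_dotProduct_mulVec {d : ℕ} {α a t₀ μ : ℝ} (hα : 0 < α)
    {A : Matrix (Fin d) (Fin d) ℝ} (hA : A.IsHermitian)
    {g : ℝ → ℝ} (hg : ContinuousOn g (Icc a t₀)) {Φ Φe : ℝ → Matrix (Fin d) (Fin d) ℝ}
    (hΦ : ∀ τ ∈ Ico a t₀,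
      Φ τ = ((t₀ - τ) ^ (α - 1) / Real.Gamma α) • (1 : Matrix (Fin d) (Fin d) ℝ)
        - (1 / Real.Gamma α) • ∫ s in τ..t₀, (s - τ) ^ (α - 1) • (g s • (A * Φ s)))
    (hΦe : ContinuousOn Φe (Icc a t₀))
    (hext : ∀ τ ∈ Ico a t₀, Φe τ = (t₀ - τ) ^ (1 - α) • Φ τ)
    {e : Fin d → ℝ} (he : A *ᵥ e = μ • e) (w : Fin d → ℝ) :
    IsVolterraSolution α (t₀ - a) (e ⬝ᵥ w) (fun t => μ * g (t₀ - t))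
      fun t => e ⬝ᵥ Φe (t₀ - t) *ᵥ w := by
  have hmaps : MapsTo (fun t => t₀ - t) (Icc 0 (t₀ - a)) (Icc a t₀) := fun t ht =>
    ⟨by linarith [ht.2], by linarith [ht.1]⟩
  have hΦc : ContinuousOn (fun t => Φe (t₀ - t)) (Icc 0 (t₀ - a)) := hΦe.comp (by fun_prop) hmaps
  have hgc : ContinuousOn (fun t => g (t₀ - t)) (Icc 0 (t₀ - a)) := hg.comp (by fun_prop) hmaps
  have hΦ' : ∀ s ∈ Ioc 0 (t₀ - a), Φ (t₀ - s) = s ^ (α - 1) • Φe (t₀ - s) := by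
    intro s hs
    rw [hext (t₀ - s) ⟨by linarith [hs.2], by linarith [hs.1]⟩, sub_sub_cancel, smul_smul,
      ← Real.rpow_add hs.1, show α - 1 + (1 - α) = 0 by ring, Real.rpow_zero, one_smul]
  have hA' : ∀ X : Matrix (Fin d) (Fin d) ℝ, e ⬝ᵥ (A * X) *ᵥ w = μ * (e ⬝ᵥ X *ᵥ w) := by
    intro X
    have hAt : Aᵀ = A := by rw [← conjTranspose_eq_transpose_of_trivial]; exact hA.eq
    rw [← mulVec_mulVec, dotProduct_mulVec, ← mulVec_transpose, hAt, he, smul_dotProduct,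
      smul_eq_mul]
  refine ⟨(Matrix.dotMulVecCLM e w).continuous.comp_continuousOn hΦc, fun t ht => ?_⟩
  have hsub : Icc 0 t ⊆ Icc 0 (t₀ - a) := Icc_subset_Icc_right ht.2
  have hF : ContinuousOn (fun s => g (t₀ - s) • (A * Φe (t₀ - s))) (Icc 0 t) :=
    (hgc.mono hsub).smul (continuousOn_const.mul (hΦc.mono hsub))
  have hint : ∫ s in (t₀ - t)..t₀, (s - (t₀ - t)) ^ (α - 1) • (g s • (A * Φ s)) =
      ∫ s in (0 : ℝ)..t, (t - s) ^ (α - 1) • s ^ (α - 1) • (g (t₀ - s) • (A * Φe (t₀ - s))) := by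
    have h1 := intervalIntegral.integral_comp_sub_left (a := 0) (b := t)
      (fun s => (s - (t₀ - t)) ^ (α - 1) • (g s • (A * Φ s))) t₀
    rw [sub_zero] at h1
    rw [← h1]
    refine intervalIntegral.integral_congr_ae (Eventually.of_forall fun s hs => ?_)
    rw [uIoc_of_le ht.1.le] at hs
    rw [hΦ' s ⟨hs.1, hs.2.trans ht.2⟩, show t₀ - s - (t₀ - t) = t - s by ring, mul_smul_comm,
      smul_comm (g (t₀ - s))]
  have hcomp : Matrix.dotMulVecCLM e w (∫ s in (0 : ℝ)..t,
      (t - s) ^ (α - 1) • s ^ (α - 1) • (g (t₀ - s) • (A * Φe (t₀ - s)))) =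
      ∫ s in (0 : ℝ)..t, Matrix.dotMulVecCLM e w
        ((t - s) ^ (α - 1) • s ^ (α - 1) • (g (t₀ - s) • (A * Φe (t₀ - s)))) :=
    (ContinuousLinearMap.intervalIntegral_comp_comm (Matrix.dotMulVecCLM e w)
      (intervalIntegrable_kernel_smul hα hα ht.1 hF)).symm
  have h := congrArg (Matrix.dotMulVecCLM e w)
    (hΦ (t₀ - t) ⟨by linarith [ht.2], by linarith [ht.1]⟩)
  rw [hΦ' t ht, hint, map_sub, map_smul, map_smul, map_smul, sub_sub_cancel,
    hcomp] at h
  simp only [map_smul, Matrix.dotMulVecCLM_apply, smul_eq_mul, hA', one_mulVec] at h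
  rw [h]
  have e1 : ∀ s, g (t₀ - s) * (μ * (e ⬝ᵥ Φe (t₀ - s) *ᵥ w)) =
      μ * g (t₀ - s) * (e ⬝ᵥ Φe (t₀ - s) *ᵥ w) := fun s => by ring
  simp_rw [e1]
  ring

/-- bounds `E_{α,α}(-λM(t₀-a)^α) ≤ ‖(t₀-τ)^{1-α} Φ(τ)‖ ≤ 1` for the
solution of the right Riemann–Liouville matrix Volterra equation
`Φ(τ) = (t₀-τ)^{α-1}/Γ(α)·𝕀 - (1/Γ(α)) ∫_τ^{t₀} (s-τ)^{α-1} g(s) A Φ(s) ds`, where `A`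
is symmetric positive semidefinite with largest eigenvalue `λ` and `0 ≤ g ≤ M`. -/
theorem rl_transition_matrix_bounds_psd
    (d : ℕ) (α a t₀ M lam : ℝ) (hα : α ∈ Set.Ioo (0:ℝ) 1) (hat : a < t₀)
    (A : Matrix (Fin d) (Fin d) ℝ) (hA : A.PosSemidef)
    (hlam_mem : ∃ i, (hA.1).eigenvalues i = lam)
    (hlam_max : ∀ i, (hA.1).eigenvalues i ≤ lam)
    (hM : 0 ≤ M) (g : ℝ → ℝ) (hg : ContinuousOn g (Set.Icc a t₀))
    (hgb : ∀ s ∈ Set.Icc a t₀, g s ∈ Set.Icc 0 M)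
    (Φ : ℝ → Matrix (Fin d) (Fin d) ℝ)
    (hΦ : ∀ τ ∈ Set.Ico a t₀,
      Φ τ = ((t₀ - τ) ^ (α - 1) / Real.Gamma α) • (1 : Matrix (Fin d) (Fin d) ℝ)
        - (1 / Real.Gamma α) • ∫ s in τ..t₀, (s - τ) ^ (α - 1) • (g s • (A * Φ s)))
    (Φe : ℝ → Matrix (Fin d) (Fin d) ℝ) (hΦe : ContinuousOn Φe (Set.Icc a t₀))
    (hext : ∀ τ ∈ Set.Ico a t₀, Φe τ = (t₀ - τ) ^ (1 - α) • Φ τ) :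
    ∀ τ ∈ Set.Ico a t₀,
      mittagLeffler2 α α (-(lam * M * (t₀ - a) ^ α)) ≤
        ‖Matrix.toEuclideanCLM (𝕜 := ℝ) ((t₀ - τ) ^ (1 - α) • Φ τ)‖ ∧
      ‖Matrix.toEuclideanCLM (𝕜 := ℝ) ((t₀ - τ) ^ (1 - α) • Φ τ)‖ ≤ 1 := by
  obtain ⟨hα0, hα1⟩ := hα
  intro τ hτ
  rw [← hext τ hτ]
  have hT : 0 < t₀ - a := sub_pos.2 hat
  have ht : t₀ - τ ∈ Ioc 0 (t₀ - a) := ⟨by linarith [hτ.2], by linarith [hτ.1]⟩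
  have hmaps : MapsTo (fun t => t₀ - t) (Icc 0 (t₀ - a)) (Icc a t₀) := fun t ht =>
    ⟨by linarith [ht.2], by linarith [ht.1]⟩
  set N := Matrix.toEuclideanCLM (𝕜 := ℝ) (Φe τ) with hN
  set bas := hA.1.eigenvectorBasis with hbas
  have hsol : ∀ i (w : EuclideanSpace ℝ (Fin d)),
      IsVolterraSolution α (t₀ - a) (inner ℝ (bas i) w)
        (fun t => hA.1.eigenvalues i * g (t₀ - t))
        fun t => inner ℝ (bas i) (Matrix.toEuclideanCLM (𝕜 := ℝ) (Φe (t₀ - t)) w) := by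
    intro i w
    have h := isVolterraSolution_dotProduct_mulVec hα0 hA.1 hg hΦ hΦe hext
      (hA.1.mulVec_eigenvectorBasis i) w.ofLp
    have e1 : ∀ x y : EuclideanSpace ℝ (Fin d), inner ℝ x y = x.ofLp ⬝ᵥ y.ofLp := fun x y => by
      rw [EuclideanSpace.inner_eq_star_dotProduct, dotProduct_comm, star_trivial]
    simpa only [e1, Matrix.ofLp_toEuclideanCLM] using h
  have hp : ∀ i, ContinuousOn (fun t => hA.1.eigenvalues i * g (t₀ - t)) (Icc 0 (t₀ - a)) :=
    fun i => continuousOn_const.mul (hg.comp (by fun_prop) hmaps)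
  have hp0 : ∀ i, ∀ t ∈ Icc 0 (t₀ - a), 0 ≤ hA.1.eigenvalues i * g (t₀ - t) := fun i t ht =>
    mul_nonneg (hA.eigenvalues_nonneg i) (hgb _ (hmaps ht)).1
  have hone : ∀ i, inner ℝ (bas i) (bas i) = 1 := fun i => by
    rw [real_inner_self_eq_norm_sq, bas.norm_eq_one, one_pow]
  constructor
  · obtain ⟨i, hi⟩ := hlam_mem
    have hlam0 : 0 ≤ lam := hi ▸ hA.eigenvalues_nonneg i
    have hc0 : 0 ≤ lam * M * (t₀ - a) ^ α := by positivity
    have htα : 0 < (t₀ - τ) ^ α := Real.rpow_pos_of_pos ht.1 α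
    have hpc : ∀ t ∈ Icc 0 (t₀ - a),
        hA.1.eigenvalues i * g (t₀ - t) ≤ lam * M * (t₀ - a) ^ α / (t₀ - τ) ^ α := by
      intro t ht'
      rw [le_div_iff₀ htα, hi]
      exact mul_le_mul (mul_le_mul_of_nonneg_left (hgb _ (hmaps ht')).2 hlam0)
        (Real.rpow_le_rpow ht.1.le ht.2 hα0.le) htα.le (by positivity)
    have hu := hsol i (bas i)
    rw [hone] at hu
    have hle := hu.le_of_le
      (isVolterraSolution_mittagLeffler2 hα0 hα1 (div_nonneg hc0 htα.le)) hα0 hα1.le hT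
      (hp i) (hp0 i) hpc (t₀ - τ) ⟨ht.1.le, ht.2⟩
    simp only [div_mul_cancel₀ _ htα.ne', sub_sub_cancel] at hle
    refine hle.trans ((le_abs_self _).trans ((abs_real_inner_le_norm _ _).trans ?_))
    rw [bas.norm_eq_one, one_mul]
    simpa using N.le_opNorm (bas i)
  · have hΓ : 1 ≤ Real.Gamma α := by
      rw [← Real.Gamma_one]
      exact Real.Gamma_strictAntiOn_Ioc.antitoneOn ⟨hα0, hα1.le⟩ ⟨one_pos, le_rfl⟩ hα1.le
    have hle : ∀ i v, |inner ℝ (bas i) (N v)| ≤ |inner ℝ (bas i) v| := by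
      intro i v
      refine (abs_le_mul_abs_of_forall_pos (C := 1)
        ((innerSL ℝ (bas i)).toLinearMap ∘ₗ N.toLinearMap) (innerSL ℝ (bas i)).toLinearMap
        (fun v hv => ?_) (e := bas i) ?_ v).trans_eq (one_mul _)
      · have hv' : 0 < inner ℝ (bas i) v := hv
        have h1 := (hsol i v).pos hα0 hα1.le hT hv' (hp i) (hp0 i) (t₀ - τ) ⟨ht.1.le, ht.2⟩
        have h2 := (hsol i v).le_div_Gamma hα0 hα1.le hT hv' (hp i) (hp0 i) ht
        simp only [sub_sub_cancel] at h1 h2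
        exact ⟨h1.le, (h2.trans (div_le_self hv'.le hΓ)).trans_eq (one_mul _).symm⟩
      · exact one_pos.trans_eq (hone i).symm
    refine ContinuousLinearMap.opNorm_le_bound _ zero_le_one fun v => ?_
    rw [one_mul]
    refine (sq_le_sq₀ (norm_nonneg _) (norm_nonneg _)).1 ?_
    rw [← bas.sum_sq_norm_inner_right, ← bas.sum_sq_norm_inner_right]
    refine Finset.sum_le_sum fun i _ => ?_
    exact pow_le_pow_left₀ (norm_nonneg _) (hle i v) 2
end
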